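/- arXiv:1606.06231 — 2 statements merged into one kernel-verified Lean document; each statement's English description precedes it below -/
import Mathlib

section
/- Suppose k ∈ ℕ and s ∈ ℝ with s ∉ {-k, ..., -1}. For a polynomial π ∈ P_{k-1} on ℝ^N, the following are equivalent: (i) π ∈ L^q_{s+k} for every 1 ≤ q ≤ ∞; (ii) π ∈ L^{q_1}_{s+k} + L^{q_2}_{s+k} for some 1 ≤ q_1, q_2 ≤ ∞ (i.e., π = f + g with f ∈ L^{q_1}_{s+k} and g ∈ L^{q_2}_{s+k}). -/
open MeasureTheory Metric Filter Topology ENNReal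

noncomputable section

/-- Euclidean space `ℝ^N`. -/
abbrev Euc (N : ℕ) := EuclideanSpace ℝ (Fin N)

/-- Iterated classical partial derivative along a list of coordinate directions. -/
def pderivList {N : ℕ} : List (Fin N) → (Euc N → ℝ) → Euc N → ℝ
  | [], φ => φ
  | i :: l, φ => pderivList l fun x => fderiv ℝ φ x (EuclideanSpace.single i 1)

/-- `g` is the weak (distributional) partial derivative of `u` of order given by the
list `l` of coordinate directions, i.e. `g = ∂_{l₁} ⋯ ∂_{l_r} u` in `D'(ℝ^N)`. -/
def IsWeakDerivList {N : ℕ} (l : List (Fin N)) (u g : Euc N → ℝ) : Prop :=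
  LocallyIntegrable u volume ∧ LocallyIntegrable g volume ∧
    ∀ φ : Euc N → ℝ, ContDiff ℝ (⊤ : ℕ∞) φ → HasCompactSupport φ →
      ∫ x, u x * pderivList l φ x = (-1 : ℝ) ^ l.length * ∫ x, g x * φ x

/-- `g` is the weak partial derivative `∂ᵢ u`. -/
def IsWeakPartialDeriv {N : ℕ} (i : Fin N) (u g : Euc N → ℝ) : Prop :=
  IsWeakDerivList [i] u g

/-- The weight `(1+|x|)^{-s-N/q}` of the space `L^q_s` (with `N/∞ := 0`). -/
def wt (N : ℕ) (s : ℝ) (q : ℝ≥0∞) (x : Euc N) : ℝ :=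
  (1 + ‖x‖) ^ (-s - (N : ℝ) / q.toReal)

/-- Membership in the weighted space `L^q_s`. -/
def MemLs (N : ℕ) (s : ℝ) (q : ℝ≥0∞) (u : Euc N → ℝ) : Prop :=
  MemLp (fun x => wt N s q x * u x) q volume

/-- The norm of the weighted space `L^q_s`. -/
def LsNorm (N : ℕ) (s : ℝ) (q : ℝ≥0∞) (u : Euc N → ℝ) : ℝ :=
  (eLpNorm (fun x => wt N s q x * u x) q volume).toReal

/-- Membership in the exponentially weighted space `L^q_{exp,s}`. -/
def MemLexp (N : ℕ) (s : ℝ) (q : ℝ≥0∞) (u : Euc N → ℝ) : Prop :=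
  MemLp (fun x => Real.exp (-(s * ‖x‖)) * u x) q volume

/-- The norm of the exponentially weighted space `L^q_{exp,s}`. -/
def LexpNorm (N : ℕ) (s : ℝ) (q : ℝ≥0∞) (u : Euc N → ℝ) : ℝ :=
  (eLpNorm (fun x => Real.exp (-(s * ‖x‖)) * u x) q volume).toReal

/-- The pointwise Euclidean (Frobenius) norm `|∇^k u|` of the `k`-th gradient, whose
components `g m` are indexed by the `k`-tuples `m` of coordinate directions. -/
def gradNormK {N k : ℕ} (g : (Fin k → Fin N) → Euc N → ℝ) (x : Euc N) : ℝ :=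
  Real.sqrt (∑ m : Fin k → Fin N, g m x ^ 2)

/-- The pointwise Euclidean norm `|∇u|` of a first-order gradient. -/
def gradNorm1 {N : ℕ} (g : Fin N → Euc N → ℝ) (x : Euc N) : ℝ :=
  Real.sqrt (∑ i, g i x ^ 2)

/-- The interval `I_{j,p}` of admissible exponents `q`. -/
def Ijp (N j : ℕ) (p : ℝ) : Set ℝ≥0∞ :=
  if p = (N : ℝ) / (j : ℝ) ∧ 1 < N then Set.Ico (ENNReal.ofReal p) ⊤
  else if p < (N : ℝ) / (j : ℝ) then
    Set.Icc (ENNReal.ofReal p) (ENNReal.ofReal ((N : ℝ) * p / ((N : ℝ) - (j : ℝ) * p)))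
  else Set.Icc (ENNReal.ofReal p) ⊤

/-- The average of `u` on the ball `B_ρ`. -/
def ballAvg {N : ℕ} (ρ : ℝ) (u : Euc N → ℝ) : ℝ :=
  (volume (ball (0 : Euc N) ρ)).toReal⁻¹ * ∫ y in ball (0 : Euc N) ρ, u y

/-- The radial symmetrization `u_S(x) = (Nω_N)⁻¹ ∫_{S^{N-1}} u(|x|σ) dσ`. -/
def radialSymmetrization {N : ℕ} (u : Euc N → ℝ) (x : Euc N) : ℝ :=
  ((N : ℝ) * (volume (ball (0 : Euc N) 1)).toReal)⁻¹ *
    ∫ σ : sphere (0 : Euc N) 1, u (‖x‖ • (σ : Euc N)) ∂((volume : Measure (Euc N)).toSphere)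

/-- `u` is radially symmetric: `u x` only depends on `|x|`. -/
def RadSymm {N : ℕ} (u : Euc N → ℝ) : Prop :=
  ∀ x y : Euc N, ‖x‖ = ‖y‖ → u x = u y

/-- Evaluation of a polynomial on `ℝ^N` at a point. -/
def polyEval {N : ℕ} (π : MvPolynomial (Fin N) ℝ) (x : Euc N) : ℝ :=
  MvPolynomial.eval (fun i => x i) π


theorem polyEval_continuous {N : ℕ} (π : MvPolynomial (Fin N) ℝ) :
    Continuous (polyEval π : Euc N → ℝ) := by
  unfold polyEval
  have h : Continuous fun x : Euc N => (fun i => x i : Fin N → ℝ) := by fun_prop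
  exact (MvPolynomial.continuous_eval π).comp h

theorem polyEval_bound {N : ℕ} (π : MvPolynomial (Fin N) ℝ) :
    ∃ C : ℝ, ∀ x : Euc N, |polyEval π x| ≤ C * (1 + ‖x‖) ^ (π.totalDegree) := by
  refine ⟨∑ d ∈ π.support, |π.coeff d|, fun x => ?_⟩
  unfold polyEval
  rw [MvPolynomial.eval_eq', Finset.sum_mul]
  refine (Finset.abs_sum_le_sum_abs _ _).trans (Finset.sum_le_sum fun d hd => ?_)
  rw [abs_mul, Finset.abs_prod]
  refine mul_le_mul_of_nonneg_left ?_ (abs_nonneg _)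
  have h1 : ∏ i, |x i ^ d i| ≤ ∏ i, (1 + ‖x‖) ^ d i := by
    refine Finset.prod_le_prod (fun i _ => abs_nonneg _) fun i _ => ?_
    rw [abs_pow]
    refine pow_le_pow_left₀ (abs_nonneg _) ?_ _
    have := PiLp.norm_apply_le x i
    rw [Real.norm_eq_abs] at this
    linarith
  refine h1.trans ?_
  rw [Finset.prod_pow_eq_pow_sum]
  refine pow_le_pow_right₀ (by linarith [norm_nonneg x]) ?_
  have := MvPolynomial.le_totalDegree hd
  rwa [Finsupp.sum_fintype _ _ (by simp)] at this

theorem cont_pow {N : ℕ} (a : ℝ) : Continuous fun x : Euc N => (1 + ‖x‖) ^ a := by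
  refine Continuous.rpow_const (by fun_prop) fun x => Or.inl ?_
  positivity

theorem memLp_pow {N : ℕ} {ε : ℝ} (hε : 0 < ε) {q : ℝ≥0∞} (hq : 1 ≤ q) :
    MemLp (fun x : Euc N => (1 + ‖x‖) ^ (-ε - (N : ℝ) / q.toReal)) q volume := by
  have hm := (cont_pow (N := N) (-ε - (N : ℝ) / q.toReal)).aestronglyMeasurable (μ := volume)
  by_cases hT : q = ⊤
  · subst hT
    refine memLp_top_of_bound hm 1 (ae_of_all _ fun x => ?_)
    rw [Real.norm_of_nonneg (by positivity)]
    refine Real.rpow_le_one_of_one_le_of_nonpos (by linarith [norm_nonneg x]) ?_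
    simp; exact hε.le
  · have hq0 : q ≠ 0 := by rintro rfl; simp at hq
    rw [← integrable_norm_rpow_iff hm hq0 hT]
    have hqp : 0 < q.toReal := ENNReal.toReal_pos hq0 hT
    have h := integrable_one_add_norm (E := Euc N) (μ := volume) (r := ε * q.toReal + N)
      (by simp; positivity)
    refine h.congr (ae_of_all _ fun x => ?_)
    have hx : (0 : ℝ) ≤ 1 + ‖x‖ := by positivity
    simp only
    rw [Real.norm_of_nonneg (by positivity), ← Real.rpow_mul hx]
    congr 1
    field_simp
    ring

theorem toL1 {N : ℕ} {t t' : ℝ} (ht : t < t') {q : ℝ≥0∞} (hq : 1 ≤ q) {f : Euc N → ℝ}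
    (hf : MemLs N t q f) : MemLs N t' 1 f := by
  unfold MemLs at *
  have hc : ENNReal.HolderConjugate q (ENNReal.conjExponent q) :=
    ENNReal.HolderConjugate.conjExponent hq
  have hp := hc.symm
  have hq' : 1 ≤ ENNReal.conjExponent q := hp.one_le
  have h := memLp_pow (N := N) (sub_pos.2 ht) hq'
  have h2 := MemLp.mul' (r := 1) hf h
  refine (memLp_congr_ae (ae_of_all _ fun x => ?_)).1 h2
  simp only [wt]
  have hx : (0 : ℝ) < 1 + ‖x‖ := by positivity
  rw [← mul_assoc, ← Real.rpow_add hx]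
  congr 2
  have e : (q⁻¹).toReal + ((ENNReal.conjExponent q)⁻¹).toReal = 1 := by
    rw [← ENNReal.toReal_add (by simp; rintro rfl; simp at hq)
      (by simp; intro h; rw [h] at hq'; simp at hq'), hc.inv_add_inv_eq_one]
    simp
  rw [ENNReal.toReal_inv, ENNReal.toReal_inv] at e
  simp only [div_eq_mul_inv, ENNReal.toReal_one]
  linear_combination (-(N : ℝ)) * e

theorem poly_scale_tendsto {N : ℕ} (π : MvPolynomial (Fin N) ℝ) (x : Euc N) :
    Tendsto (fun n : ℕ => (((n : ℝ) + 1)⁻¹) ^ π.totalDegree * polyEval π (((n : ℝ) + 1) • x))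
      atTop (𝓝 (polyEval (MvPolynomial.homogeneousComponent π.totalDegree π) x)) := by
  set d := π.totalDegree with hd
  have hR : Tendsto (fun n : ℕ => ((n : ℝ) + 1)⁻¹) atTop (𝓝 0) := by
    simpa [one_div] using tendsto_one_div_add_atTop_nhds_zero_nat (𝕜 := ℝ)
  have key : ∀ n : ℕ, (((n : ℝ) + 1)⁻¹) ^ d * polyEval π (((n : ℝ) + 1) • x)
      = ∑ i ∈ Finset.range (d + 1), (((n : ℝ) + 1)⁻¹) ^ (d - i) *
        polyEval (MvPolynomial.homogeneousComponent i π) x := by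
    intro n
    have hn : ((n : ℝ) + 1) ≠ 0 := by positivity
    have h0 : polyEval π (((n : ℝ) + 1) • x) = ∑ i ∈ Finset.range (d + 1),
        polyEval (MvPolynomial.homogeneousComponent i π) (((n : ℝ) + 1) • x) := by
      unfold polyEval
      rw [← map_sum, hd, MvPolynomial.sum_homogeneousComponent]
    rw [h0, Finset.mul_sum]
    refine Finset.sum_congr rfl fun i hi => ?_
    have hi' : i ≤ d := by simp at hi; omega
    have hh := MvPolynomial.homogeneousComponent_isHomogeneous i π
    have h1 : polyEval (MvPolynomial.homogeneousComponent i π) (((n : ℝ) + 1) • x)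
        = ((n : ℝ) + 1) ^ i * polyEval (MvPolynomial.homogeneousComponent i π) x := by
      unfold polyEval
      rw [MvPolynomial.eval_eq', MvPolynomial.eval_eq', Finset.mul_sum]
      refine Finset.sum_congr rfl fun e he => ?_
      have hdeg := hh (MvPolynomial.mem_support_iff.1 he)
      have hdeg' : ∑ j, e j = i := by
        rw [← hdeg, Finsupp.weight_apply, Finsupp.sum_fintype _ _ (by simp)]
        simp
      have : ∏ j, ((((n : ℝ) + 1) • x) j) ^ e j = ((n : ℝ) + 1) ^ i * ∏ j, (x j) ^ e j := by
        rw [← hdeg', ← Finset.prod_pow_eq_pow_sum, ← Finset.prod_mul_distrib]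
        refine Finset.prod_congr rfl fun j _ => ?_
        simp [mul_pow]
      rw [this]; ring
    rw [h1, ← mul_assoc]
    congr 1
    obtain ⟨m, hm⟩ := Nat.exists_eq_add_of_le hi'
    rw [hm, Nat.add_sub_cancel_left, pow_add, inv_pow, inv_pow]
    field_simp
  simp_rw [key, Finset.sum_range_succ]
  have h2 : Tendsto (fun n : ℕ => ∑ i ∈ Finset.range d, (((n : ℝ) + 1)⁻¹) ^ (d - i) *
        polyEval (MvPolynomial.homogeneousComponent i π) x) atTop (𝓝 (∑ i ∈ Finset.range d, 0)) := by
    refine tendsto_finsetSum _ fun i hi => ?_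
    have hi' : d - i ≠ 0 := by simp at hi; omega
    simpa [hi'] using (hR.pow (d - i)).mul_const
      (polyEval (MvPolynomial.homogeneousComponent i π) x)
  simpa using h2.add_const (polyEval (MvPolynomial.homogeneousComponent d π) x)

theorem hom_ne_zero {N : ℕ} {π : MvPolynomial (Fin N) ℝ} (h0 : π ≠ 0) :
    MvPolynomial.homogeneousComponent π.totalDegree π ≠ 0 := by
  intro h
  obtain ⟨e, he, hed⟩ := Finset.exists_mem_eq_sup π.support
    (MvPolynomial.support_nonempty.2 h0) (fun s => s.sum fun _ e => e)
  have hc := MvPolynomial.coeff_homogeneousComponent π.totalDegree π e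
  rw [h] at hc
  have : e.degree = π.totalDegree := by
    unfold MvPolynomial.totalDegree
    rw [hed]; rfl
  rw [if_pos this] at hc
  exact MvPolynomial.mem_support_iff.1 he (by simpa using hc.symm)

theorem not_L1 {N : ℕ} {π : MvPolynomial (Fin N) ℝ} (h0 : π ≠ 0) {t : ℝ}
    (ht : t < π.totalDegree) (htN : 0 ≤ t + N) (h : MemLs N t 1 (polyEval π)) : False := by
  set d := π.totalDegree with hd
  set a : ℝ := t + N with ha
  set H := MvPolynomial.homogeneousComponent d π with hH
  let G : Euc N → ℝ≥0∞ := fun z => ENNReal.ofReal ((1 + ‖z‖) ^ (-a) * |polyEval π z|)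
  let F : ℕ → Euc N → ℝ≥0∞ := fun n x => ENNReal.ofReal ((1 + ‖x‖) ^ (-a) *
    |(((n : ℝ) + 1)⁻¹) ^ d * polyEval π (((n : ℝ) + 1) • x)|)
  have hGc : Continuous G :=
    ENNReal.continuous_ofReal.comp ((cont_pow _).mul (polyEval_continuous π).abs)
  have hGfin : ∫⁻ z, G z ≠ ⊤ := by
    have h1 := (memLp_one_iff_integrable.1 h).2
    rw [hasFiniteIntegral_iff_norm] at h1
    refine ne_of_lt (lt_of_eq_of_lt (lintegral_congr fun z => ?_) h1)
    simp only [G, wt, norm_mul, Real.norm_eq_abs, ENNReal.toReal_one, div_one]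
    rw [abs_of_nonneg (a := (1 + ‖z‖) ^ _) (by positivity), ha]
    congr 3
    ring
  have hFm : ∀ n, Measurable (F n) := fun n => by
    refine (ENNReal.continuous_ofReal.comp ((cont_pow _).mul (Continuous.abs ?_))).measurable
    exact continuous_const.mul ((polyEval_continuous π).comp (continuous_const_smul _))
  have hFlim : ∀ x, Tendsto (fun n => F n x) atTop
      (𝓝 (ENNReal.ofReal ((1 + ‖x‖) ^ (-a) * |polyEval H x|))) := fun x =>
    (ENNReal.continuous_ofReal.tendsto _).comp
      ((poly_scale_tendsto π x).abs.const_mul ((1 + ‖x‖) ^ (-a)))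
  have hFle : ∀ n, ∫⁻ x, F n x ≤ ENNReal.ofReal (((n : ℝ) + 1) ^ (t - d)) * ∫⁻ z, G z := by
    intro n
    set R : ℝ := (n : ℝ) + 1 with hRdef
    have hR1 : 1 ≤ R := by simp [hRdef]
    have hR0 : 0 < R := by linarith
    have p1 : ∀ x, F n x ≤ ENNReal.ofReal (R ^ (a - d)) * G (R • x) := by
      intro x
      simp only [F, G]
      rw [← ENNReal.ofReal_mul (by positivity)]
      refine ENNReal.ofReal_le_ofReal ?_
      rw [abs_mul, abs_of_nonneg (a := R⁻¹ ^ d) (by positivity), ← mul_assoc, ← mul_assoc]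
      refine mul_le_mul_of_nonneg_right ?_ (abs_nonneg _)
      have q1 : (1 + ‖x‖) ^ (-a) ≤ R ^ a * (1 + ‖R • x‖) ^ (-a) := by
        rw [norm_smul, Real.norm_of_nonneg hR0.le, Real.rpow_neg (by positivity),
          Real.rpow_neg (by positivity), ← div_eq_mul_inv, ← Real.div_rpow hR0.le (by positivity),
          ← Real.inv_rpow (by positivity)]
        refine Real.rpow_le_rpow (by positivity) ?_ htN
        rw [inv_eq_one_div, div_le_div_iff₀ (by positivity) (by positivity)]
        nlinarith
      rw [Real.rpow_sub hR0, Real.rpow_natCast, inv_pow]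
      calc (1 + ‖x‖) ^ (-a) * (R ^ d)⁻¹ ≤ R ^ a * (1 + ‖R • x‖) ^ (-a) * (R ^ d)⁻¹ :=
            mul_le_mul_of_nonneg_right q1 (by positivity)
        _ = _ := by ring
    have p2 : ∫⁻ x, G (R • x) = ENNReal.ofReal (R ^ (-(N : ℝ))) * ∫⁻ z, G z := by
      have e := Measure.map_addHaar_smul (volume : Measure (Euc N)) hR0.ne'
      rw [← lintegral_map (f := G) (g := fun x : Euc N => R • x) hGc.measurable (by fun_prop), e,
        lintegral_smul_measure, smul_eq_mul]
      congr 2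
      rw [abs_of_nonneg (by positivity), Real.rpow_neg hR0.le, Real.rpow_natCast]
      simp
    calc ∫⁻ x, F n x ≤ ∫⁻ x, ENNReal.ofReal (R ^ (a - d)) * G (R • x) := lintegral_mono p1
      _ = ENNReal.ofReal (R ^ (a - d)) * ∫⁻ x, G (R • x) :=
          lintegral_const_mul' _ _ ENNReal.ofReal_ne_top
      _ = _ := by
          rw [p2, ← mul_assoc, ← ENNReal.ofReal_mul (by positivity), ← Real.rpow_add hR0]
          congr 3
          rw [ha]; ring
  have hlim0 : Tendsto (fun n : ℕ => ENNReal.ofReal (((n : ℝ) + 1) ^ (t - d)) * ∫⁻ z, G z)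
      atTop (𝓝 0) := by
    have r1 : Tendsto (fun n : ℕ => ((n : ℝ) + 1) ^ (t - d)) atTop (𝓝 0) := by
      have := (tendsto_rpow_neg_atTop (y := d - t) (by linarith)).comp
        (tendsto_atTop_add_const_right atTop (1 : ℝ) tendsto_natCast_atTop_atTop)
      simpa [Function.comp_def] using this
    have r2 := (ENNReal.continuous_ofReal.tendsto _).comp r1
    have r3 := ENNReal.Tendsto.mul_const r2 (b := ∫⁻ z, G z) (Or.inr hGfin)
    simpa [Function.comp_def] using r3
  have hz : ∫⁻ x : Euc N, ENNReal.ofReal ((1 + ‖x‖) ^ (-a) * |polyEval H x|) = 0 := by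
    have f1 := lintegral_liminf_le (μ := volume) (u := atTop) hFm
    have f2 : liminf (fun n => ∫⁻ x, F n x) atTop = 0 :=
      (tendsto_of_tendsto_of_tendsto_of_le_of_le tendsto_const_nhds hlim0
        (fun _ => zero_le) hFle).liminf_eq
    rw [f2, lintegral_congr fun x => (hFlim x).liminf_eq] at f1
    exact le_antisymm f1 (zero_le)
  have hc : Continuous fun x : Euc N => ENNReal.ofReal ((1 + ‖x‖) ^ (-a) * |polyEval H x|) :=
    ENNReal.continuous_ofReal.comp ((cont_pow _).mul (polyEval_continuous H).abs)
  rw [lintegral_eq_zero_iff hc.measurable] at hz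
  have hz' := Continuous.ae_eq_iff_eq volume hc continuous_const |>.1 hz
  refine hom_ne_zero h0 (MvPolynomial.funext fun y => ?_)
  have := congrFun hz' (WithLp.toLp 2 y)
  replace this := ENNReal.ofReal_eq_zero.1 this
  have hpos : (0 : ℝ) < (1 + ‖(WithLp.toLp 2 y : Euc N)‖) ^ (-a) := by positivity
  have h3 : |polyEval H (WithLp.toLp 2 y)| ≤ 0 := by
    by_contra hcon
    push Not at hcon
    exact absurd this (not_le.2 (mul_pos hpos hcon))
  simpa [polyEval] using h3

/-- Lemma 11. For `k ≥ 1`, `s ∉ {-k,…,-1}` and a polynomial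
`π ∈ P_{k-1}`, the following are equivalent: (i) `π ∈ L^q_{s+k}` for every
`1 ≤ q ≤ ∞`; (ii) `π ∈ L^{q₁}_{s+k} + L^{q₂}_{s+k}` for some `1 ≤ q₁, q₂ ≤ ∞`. -/
theorem stmt_15 {N : ℕ} (hN : 1 ≤ N) (k : ℕ) (hk : 1 ≤ k) (s : ℝ)
    (hs : ∀ m : ℕ, 1 ≤ m → m ≤ k → s ≠ -(m : ℝ))
    (π : MvPolynomial (Fin N) ℝ) (hπ : π.totalDegree ≤ k - 1) :
    (∀ q : ℝ≥0∞, 1 ≤ q → MemLs N (s + k) q (polyEval π)) ↔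
      (∃ (q₁ q₂ : ℝ≥0∞) (f g : Euc N → ℝ), 1 ≤ q₁ ∧ 1 ≤ q₂ ∧
        (∀ x, polyEval π x = f x + g x) ∧
        MemLs N (s + k) q₁ f ∧ MemLs N (s + k) q₂ g) := by
  constructor
  · intro h
    refine ⟨1, 1, polyEval π, fun _ => 0, le_rfl, le_rfl, by simp, h 1 le_rfl, ?_⟩
    simp [MemLs]
  · rintro ⟨q₁, q₂, f, g, hq₁, hq₂, hfg, hf, hg⟩ q hq
    by_cases h0 : π = 0
    · subst h0
      simp [MemLs, polyEval]
    have hlt : (π.totalDegree : ℝ) < s + k := by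
      by_contra hcon
      have hne : s + k ≠ (π.totalDegree : ℝ) := by
        intro he
        refine hs (k - π.totalDegree) (by omega) (by omega) ?_
        rw [Nat.cast_sub (by omega)]
        linarith
      have hlt : s + k < (π.totalDegree : ℝ) := lt_of_le_of_ne (not_lt.1 hcon) hne
      have hN' : (1 : ℝ) ≤ N := by exact_mod_cast hN
      have hd0 : (0 : ℝ) ≤ π.totalDegree := by positivity
      set t' : ℝ := max ((s + k + π.totalDegree) / 2) (π.totalDegree - 1 / 2) with ht'
      have b1 : s + k < t' := lt_of_lt_of_le (by linarith) (le_max_left _ _)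
      have b2 : t' < π.totalDegree := max_lt (by linarith) (by linarith)
      have b3 : (π.totalDegree : ℝ) - 1 / 2 ≤ t' := le_max_right _ _
      refine not_L1 h0 b2 (by linarith) ?_
      have hs1 := (toL1 b1 hq₁ hf).add (toL1 b1 hq₂ hg)
      refine (memLp_congr_ae (ae_of_all _ fun x => ?_)).1 hs1
      simp only [Pi.add_apply, hfg x]
      ring
    obtain ⟨C, hC⟩ := polyEval_bound π
    have hm := memLp_pow (N := N) (sub_pos.2 hlt) hq
    refine hm.of_le_mul (c := C) ?_ (ae_of_all _ fun x => ?_)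
    · exact ((cont_pow _).mul (polyEval_continuous π)).aestronglyMeasurable
    · have hx : (0 : ℝ) < 1 + ‖x‖ := by positivity
      simp only [wt]
      rw [norm_mul, Real.norm_of_nonneg (Real.rpow_nonneg hx.le _),
        Real.norm_of_nonneg (Real.rpow_nonneg hx.le _), Real.norm_eq_abs]
      calc _ ≤ (1 + ‖x‖) ^ (-(s + k) - (N : ℝ) / q.toReal) *
            (C * (1 + ‖x‖) ^ (π.totalDegree : ℝ)) := by
            rw [Real.rpow_natCast]
            exact mul_le_mul_of_nonneg_left (hC x) (Real.rpow_nonneg hx.le _)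
        _ = C * ((1 + ‖x‖) ^ (-(s + k) - (N : ℝ) / q.toReal) *
            (1 + ‖x‖) ^ (π.totalDegree : ℝ)) := by ring
        _ = _ := by
            rw [← Real.rpow_add hx]
            congr 2
            ring


end
end

section
/- Suppose k ∈ ℕ, 1 ≤ p < ∞ and s ∈ ℝ with s ∉ {-k, ..., -1}. Then for every 1 ≤ q ≤ ∞ the weighted Sobolev space W^{k,q,p}_s is contained in W^{k,p,p}_s, and the inclusion W^{k,q,p}_s ↪ W^{k,p,p}_s is a continuous embedding. -/
open MeasureTheory Metric Filter Topology ENNReal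

noncomputable section

/-- Dilation difference operator. -/
def TT {V : Type*} [AddCommGroup V] [Module ℝ V] (c : ℝ) (F : V → ℝ) (x : V) : ℝ :=
  F x - (2 : ℝ) ^ (-c) * F ((2 : ℝ) • x)

/-- Iterated dilation differences `T_c T_{c+1} ⋯ T_{c+n-1}`. -/
def EE {V : Type*} [AddCommGroup V] [Module ℝ V] : ℕ → ℝ → (V → ℝ) → V → ℝ
  | 0, _, F => F
  | n + 1, c, F => TT c (EE n (c + 1) F)

lemma EE_ray {V : Type*} [AddCommGroup V] [Module ℝ V] (n : ℕ) (c : ℝ) (F : V → ℝ) (h : V)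
    (t : ℝ) : EE n c F (t • h) = EE n c (fun τ : ℝ => F (τ • h)) t := by
  induction n generalizing c t with
  | zero => rfl
  | succ n ih =>
    simp only [EE, TT]
    rw [ih, ← ih (c + 1) ((2 : ℝ) • t), smul_assoc]

lemma EE_hasDerivAt (n : ℕ) (c : ℝ) (f f' : ℝ → ℝ) (hf : ∀ t, HasDerivAt f (f' t) t) (t : ℝ) :
    HasDerivAt (EE n c f) (EE n (c - 1) f' t) t := by
  induction n generalizing c t with
  | zero => exact hf t
  | succ n ih =>
    have h1 := ih (c + 1) t
    have h2 : HasDerivAt (fun t : ℝ => EE n (c + 1) f ((2 : ℝ) • t))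
        (EE n (c + 1 - 1) f' ((2 : ℝ) • t) * 2) t := by
      refine HasDerivAt.comp t (ih (c + 1) ((2 : ℝ) • t)) ?_
      have h0 : HasDerivAt (fun t : ℝ => 2 * t) 2 t := by
        simpa using (hasDerivAt_id t).const_mul (2 : ℝ)
      exact h0
    have h3 := h1.sub (h2.const_mul ((2 : ℝ) ^ (-c)))
    refine h3.congr_deriv ?_
    simp only [EE, TT]
    have : (2 : ℝ) ^ (-(c - 1)) = 2 ^ (-c) * 2 := by
      rw [show -(c - 1) = -c + 1 by ring, Real.rpow_add (by norm_num), Real.rpow_one]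
    rw [this, show c + 1 - 1 = c - 1 + 1 by ring]
    ring

lemma EE_continuous {V : Type*} [AddCommGroup V] [Module ℝ V] [TopologicalSpace V]
    [ContinuousConstSMul ℝ V] (n : ℕ) (c : ℝ) (F : V → ℝ) (hF : Continuous F) :
    Continuous (EE n c F) := by
  induction n generalizing c with
  | zero => exact hF
  | succ n ih =>
    unfold EE TT
    exact (ih _).sub (continuous_const.mul ((ih _).comp (continuous_const_smul _)))

lemma EE_taylor (k : ℕ) (f : ℝ → ℝ) (hf : ContDiff ℝ (⊤ : ℕ∞) f) (r : ℝ) (hr : 0 < r) :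
    |EE (k + 1) 0 f r| ≤ (2 ^ k * r) ^ k *
      ∫ t in r..(2 ^ (k + 1) * r), |iteratedDeriv (k + 1) f t| := by
  induction k generalizing f r with
  | zero =>
    have hd : ∀ t, HasDerivAt f (deriv f t) t := fun t =>
      ((hf.differentiable (by simp)) t).hasDerivAt
    have hc : Continuous (deriv f) := hf.continuous_deriv (by simp)
    have := intervalIntegral.integral_eq_sub_of_hasDerivAt (a := r) (b := 2 * r)
      (fun t _ => hd t) (hc.intervalIntegrable _ _)
    simp only [EE, TT, iteratedDeriv_one, zero_add, pow_one, pow_zero, one_mul, neg_zero,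
      Real.rpow_zero, smul_eq_mul]
    rw [abs_sub_comm, ← this]
    exact intervalIntegral.abs_integral_le_integral_abs (by linarith)
  | succ k ih =>
    have hd : ∀ t, HasDerivAt f (deriv f t) t := fun t =>
      ((hf.differentiable (by simp)) t).hasDerivAt
    have hf' : ContDiff ℝ (⊤ : ℕ∞) (deriv f) := by
      have : ContDiff ℝ ((⊤ : ℕ∞) + 1) f := by simpa using hf
      exact this.deriv'
    have hD := EE_hasDerivAt (k + 1) 1 f (deriv f) hd
    have hcont : Continuous (EE (k + 1) 0 (deriv f)) := EE_continuous _ _ _ hf'.continuous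
    have := intervalIntegral.integral_eq_sub_of_hasDerivAt (a := r) (b := 2 * r)
      (fun t _ => hD t) (by simpa using hcont.intervalIntegrable _ _)
    have e1 : EE (k + 1 + 1) 0 f r = EE (k + 1) 1 f r - EE (k + 1) 1 f (2 * r) := by
      simp [EE, TT]
    have hcI : Continuous fun t => |iteratedDeriv (k + 1 + 1) f t| :=
      (hf.continuous_iteratedDeriv _ (by exact_mod_cast le_top)).abs
    rw [e1, abs_sub_comm, ← this]
    set I := ∫ t in r..(2 ^ (k + 1 + 1) * r), |iteratedDeriv (k + 1 + 1) f t| with hI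
    have hI0 : 0 ≤ I := intervalIntegral.integral_nonneg
      (by nlinarith [one_le_pow₀ (M₀ := ℝ) (a := 2) (by norm_num) (n := k + 1 + 1)])
      (fun _ _ => abs_nonneg _)
    have key : ∀ t ∈ Set.uIoc r (2 * r), ‖EE (k + 1) (1 - 1) (deriv f) t‖ ≤
        (2 ^ (k + 1) * r) ^ k * I := by
      intro t ht
      rw [Set.uIoc_of_le (by linarith)] at ht
      have ht0 : 0 < t := hr.trans ht.1
      rw [Real.norm_eq_abs, sub_self]
      refine (ih (deriv f) hf' t ht0).trans ?_
      have h1 : (2 ^ k * t) ^ k ≤ (2 ^ (k + 1) * r) ^ k := by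
        apply pow_le_pow_left₀ (by positivity)
        rw [pow_succ, mul_assoc]
        exact mul_le_mul_of_nonneg_left ht.2 (by positivity)
      have h2 : ∫ τ in t..(2 ^ (k + 1) * t), |iteratedDeriv (k + 1) (deriv f) τ| ≤ I := by
        rw [← iteratedDeriv_succ']
        have h1t : t ≤ 2 ^ (k + 1) * t := by
          nlinarith [one_le_pow₀ (M₀ := ℝ) (a := 2) (by norm_num) (n := k + 1)]
        refine intervalIntegral.integral_mono_interval ht.1.le h1t ?_ ?_ ?_
        · rw [pow_succ (n := k + 1), mul_assoc]
          exact mul_le_mul_of_nonneg_left ht.2 (by positivity)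
        · exact Eventually.of_forall fun _ => abs_nonneg _
        · exact hcI.intervalIntegrable _ _
      exact mul_le_mul h1 h2 (intervalIntegral.integral_nonneg
        (by nlinarith [one_le_pow₀ (M₀ := ℝ) (a := 2) (by norm_num) (n := k + 1)])
        (fun _ _ => abs_nonneg _)) (by positivity)
    have := intervalIntegral.norm_integral_le_of_norm_le_const key
    rw [Real.norm_eq_abs] at this
    refine this.trans ?_
    rw [show 2 * r - r = r by ring, abs_of_pos hr]
    have hr2 : r ≤ 2 ^ (k + 1) * r := by
      nlinarith [one_le_pow₀ (M₀ := ℝ) (a := 2) (by norm_num) (n := k + 1)]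
    calc (2 ^ (k + 1) * r) ^ k * I * r ≤ (2 ^ (k + 1) * r) ^ k * I * (2 ^ (k + 1) * r) :=
          mul_le_mul_of_nonneg_left hr2 (by positivity)
      _ = _ := by ring

lemma contDiff_pd {N : ℕ} (i : Fin N) (v : Euc N → ℝ) (hv : ContDiff ℝ (⊤ : ℕ∞) v) :
    ContDiff ℝ (⊤ : ℕ∞) (fun x => fderiv ℝ v x (EuclideanSpace.single i 1)) := by
  have : ContDiff ℝ (⊤ : ℕ∞) (fderiv ℝ v) := hv.fderiv_right (by simp)
  exact this.clm_apply contDiff_const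

lemma contDiff_pderivList {N : ℕ} (l : List (Fin N)) (v : Euc N → ℝ)
    (hv : ContDiff ℝ (⊤ : ℕ∞) v) : ContDiff ℝ (⊤ : ℕ∞) (pderivList l v) := by
  induction l generalizing v with
  | nil => exact hv
  | cons i l ih => exact ih _ (contDiff_pd i v hv)

/-- The `ℓ¹` size of the `k`-th gradient. -/
def GG {N : ℕ} (k : ℕ) (v : Euc N → ℝ) (x : Euc N) : ℝ :=
  ∑ m : Fin k → Fin N, |pderivList (List.ofFn m) v x|

lemma GG_continuous {N : ℕ} (k : ℕ) (v : Euc N → ℝ) (hv : ContDiff ℝ (⊤ : ℕ∞) v) :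
    Continuous (GG k v) :=
  continuous_finsetSum _ fun _ _ => (contDiff_pderivList _ v hv).continuous.abs

lemma GG_nonneg {N : ℕ} (k : ℕ) (v : Euc N → ℝ) (x : Euc N) : 0 ≤ GG k v x :=
  Finset.sum_nonneg fun _ _ => abs_nonneg _

lemma GG_succ {N : ℕ} (k : ℕ) (v : Euc N → ℝ) (x : Euc N) :
    GG (k + 1) v x = ∑ i, GG k (fun x => fderiv ℝ v x (EuclideanSpace.single i 1)) x := by
  unfold GG
  rw [← (Fin.consEquiv (fun _ => Fin N)).sum_comp, Fintype.sum_prod_type]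
  simp [Fin.consEquiv, List.ofFn_succ, pderivList]

lemma line_iteratedDeriv {N : ℕ} (k : ℕ) (v : Euc N → ℝ) (hv : ContDiff ℝ (⊤ : ℕ∞) v)
    (y h : Euc N) (t : ℝ) :
    |iteratedDeriv k (fun t : ℝ => v (y + t • h)) t| ≤ ‖h‖ ^ k * GG k v (y + t • h) := by
  induction k generalizing v with
  | zero => simp [GG, pderivList]
  | succ k ih =>
    rw [iteratedDeriv_succ']
    have hd : deriv (fun t : ℝ => v (y + t • h)) = ∑ i : Fin N, fun t : ℝ =>
        h i * (fun x => fderiv ℝ v x (EuclideanSpace.single i 1)) (y + t • h) := by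
      ext t
      have h1 : HasDerivAt (fun t : ℝ => y + t • h) h t := by
        simpa using ((hasDerivAt_id t).smul_const h).const_add y
      have h2 := ((hv.differentiable (by simp)) (y + t • h)).hasFDerivAt.comp_hasDerivAt t h1
      rw [show (fun t : ℝ => v (y + t • h)) = v ∘ (fun t : ℝ => y + t • h) from rfl, h2.deriv]
      have hh : h = ∑ i, h i • EuclideanSpace.single i (1 : ℝ) := by
        simpa using ((EuclideanSpace.basisFun (Fin N) ℝ).sum_repr h).symm
      simp only [Finset.sum_apply]
      generalize y + t • h = z at *
      have h4 : fderiv ℝ v z h = fderiv ℝ v z (∑ i, h i • EuclideanSpace.single i (1 : ℝ)) :=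
        congrArg _ hh
      rw [h4]
      simp [map_sum, Finset.sum_apply]
    have hl : ContDiff ℝ (⊤ : ℕ∞) (fun t : ℝ => y + t • h) :=
      contDiff_const.add (contDiff_id.smul contDiff_const)
    rw [hd, iteratedDeriv_sum]
    · rw [GG_succ, Finset.mul_sum]
      refine (Finset.abs_sum_le_sum_abs _ _).trans (Finset.sum_le_sum fun i _ => ?_)
      rw [iteratedDeriv_const_mul_field, abs_mul, pow_succ', mul_assoc]
      refine mul_le_mul ?_ (ih _ (contDiff_pd i v hv)) (abs_nonneg _) (norm_nonneg _)
      simpa using PiLp.norm_apply_le h i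
    · intro i _
      have h3 : ContDiff ℝ (⊤ : ℕ∞) (fun t : ℝ => h i *
          (fun x => fderiv ℝ v x (EuclideanSpace.single i 1)) (y + t • h)) :=
        contDiff_const.mul ((contDiff_pd i v hv).comp hl)
      exact (h3.of_le (by exact_mod_cast le_top)).contDiffAt

/-- Pointwise bound of the dilation difference by the `k`-th gradient. -/
lemma EE_pointwise {N : ℕ} (k : ℕ) (hk : 1 ≤ k) : ∃ C : NNReal, ∀ (v : Euc N → ℝ),
    ContDiff ℝ (⊤ : ℕ∞) v → ∀ y h : Euc N,
    ‖EE k 0 (fun z => v (y + z)) h‖ₑ ≤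
      C * (‖h‖ₑ ^ k * ∫⁻ t in Set.Ioc (1 : ℝ) (2 ^ k), ‖GG k v (y + t • h)‖ₑ) := by
  obtain ⟨k, rfl⟩ := Nat.exists_eq_add_of_le' hk
  refine ⟨(2 ^ k) ^ k, fun v hv y h => ?_⟩
  have hl : ContDiff ℝ (⊤ : ℕ∞) (fun t : ℝ => y + t • h) :=
    contDiff_const.add (contDiff_id.smul contDiff_const)
  have h1 := EE_taylor k (fun t : ℝ => v (y + t • h)) (hv.comp hl) 1 one_pos
  have h2 := EE_ray (k + 1) 0 (fun z => v (y + z)) h 1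
  rw [one_smul] at h2
  rw [← h2, mul_one, mul_one] at h1
  have h12 : (1 : ℝ) ≤ 2 ^ (k + 1) := one_le_pow₀ (by norm_num)
  have hcG : Continuous fun t : ℝ => GG (k + 1) v (y + t • h) :=
    (GG_continuous _ v hv).comp hl.continuous
  have h3 : ∫ t in (1 : ℝ)..2 ^ (k + 1), |iteratedDeriv (k + 1) (fun t : ℝ => v (y + t • h)) t| ≤
      ‖h‖ ^ (k + 1) * ∫ t in (1 : ℝ)..2 ^ (k + 1), GG (k + 1) v (y + t • h) := by
    rw [← intervalIntegral.integral_const_mul]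
    refine intervalIntegral.integral_mono_on h12 ?_ ?_ fun t _ => line_iteratedDeriv _ v hv y h t
    · exact (((hv.comp hl).continuous_iteratedDeriv _ (by exact_mod_cast le_top)).abs).intervalIntegrable _ _
    · exact (hcG.const_mul _).intervalIntegrable _ _
  have h4 : ∫⁻ t in Set.Ioc (1 : ℝ) (2 ^ (k + 1)), ‖GG (k + 1) v (y + t • h)‖ₑ =
      ENNReal.ofReal (∫ t in (1 : ℝ)..2 ^ (k + 1), GG (k + 1) v (y + t • h)) := by
    rw [intervalIntegral.integral_of_le h12, ofReal_integral_eq_lintegral_ofReal]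
    · simp_rw [Real.enorm_of_nonneg (GG_nonneg _ _ _)]
    · exact (hcG.integrableOn_Icc).mono_set Set.Ioc_subset_Icc_self
    · exact Eventually.of_forall fun _ => GG_nonneg _ _ _
  rw [h4, Real.enorm_eq_ofReal_abs]
  refine (ENNReal.ofReal_le_ofReal (h1.trans (mul_le_mul_of_nonneg_left h3 (by positivity)))).trans ?_
  rw [ENNReal.ofReal_mul (by positivity), ENNReal.ofReal_mul (by positivity),
    ENNReal.ofReal_pow (norm_nonneg _), ofReal_norm]
  gcongr
  rw [← ENNReal.ofReal_coe_nnreal]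
  apply ENNReal.ofReal_le_ofReal
  push_cast; exact le_rfl

/-- `F` is controlled by its dilation difference and its dilates. -/
lemma EE_recover {V : Type*} [AddCommGroup V] [Module ℝ V] (n : ℕ) (c : ℝ) :
    ∃ C : NNReal, ∀ (F : V → ℝ) (h : V),
      |F h - EE n c F h| ≤ C * ∑ i ∈ Finset.range n, |F ((2 : ℝ) ^ (i + 1) • h)| := by
  induction n generalizing c with
  | zero => exact ⟨0, fun F h => by simp [EE]⟩
  | succ n ih =>
    obtain ⟨C, hC⟩ := ih (c + 1)
    have hb : (0 : ℝ) ≤ (2 : ℝ) ^ (-c) := by positivity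
    refine ⟨C + Real.toNNReal (2 ^ (-c)) * (1 + C), fun F h => ?_⟩
    have h1 := hC F h
    have h2 := hC F ((2 : ℝ) • h)
    set S := ∑ i ∈ Finset.range (n + 1), |F ((2 : ℝ) ^ (i + 1) • h)| with hS
    have s1 : ∑ i ∈ Finset.range n, |F ((2 : ℝ) ^ (i + 1) • h)| ≤ S := by
      rw [hS, Finset.sum_range_succ]
      linarith [abs_nonneg (F ((2 : ℝ) ^ (n + 1) • h))]
    have s2 : |F ((2 : ℝ) • h)| + ∑ i ∈ Finset.range n, |F ((2 : ℝ) ^ (i + 1) • (2 : ℝ) • h)| = S := by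
      rw [hS, Finset.sum_range_succ', add_comm]
      simp [smul_smul, pow_succ]
    have s3 : |F ((2 : ℝ) • h)| ≤ S := by
      rw [← s2]; linarith [Finset.sum_nonneg (s := Finset.range n) (f := fun i => |F ((2 : ℝ) ^ (i + 1) • (2 : ℝ) • h)|) fun _ _ => abs_nonneg _]
    have s4 : ∑ i ∈ Finset.range n, |F ((2 : ℝ) ^ (i + 1) • (2 : ℝ) • h)| ≤ S := by
      rw [← s2]; linarith [abs_nonneg (F ((2 : ℝ) • h))]
    have hC0 : (0 : ℝ) ≤ C := C.2
    have h3 : |EE n (c + 1) F ((2 : ℝ) • h)| ≤ (1 + C) * S := by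
      have : |EE n (c + 1) F ((2 : ℝ) • h)| ≤ |F ((2 : ℝ) • h)| +
          |F ((2 : ℝ) • h) - EE n (c + 1) F ((2 : ℝ) • h)| := by
        have := abs_sub (F ((2 : ℝ) • h)) (F ((2 : ℝ) • h) - EE n (c + 1) F ((2 : ℝ) • h))
        simpa using this
      nlinarith
    have e : F h - EE (n + 1) c F h =
        (F h - EE n (c + 1) F h) + 2 ^ (-c) * EE n (c + 1) F ((2 : ℝ) • h) := by
      simp only [EE, TT]; ring
    rw [e]
    refine (abs_add_le _ _).trans ?_
    rw [abs_mul, abs_of_nonneg hb]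
    have h5 := mul_le_mul_of_nonneg_left h3 hb
    have h6 := mul_le_mul_of_nonneg_left s1 hC0
    push_cast
    rw [Real.coe_toNNReal _ hb]
    nlinarith

lemma eLp_le_mul {α ε ε' : Type*} [MeasurableSpace α] [TopologicalSpace ε] [ContinuousENorm ε]
    [TopologicalSpace ε'] [ContinuousENorm ε'] {f : α → ε} {g : α → ε'} {μ : Measure α}
    {P : ℝ≥0∞} (c : NNReal) (h : ∀ᵐ x ∂μ, ‖f x‖ₑ ≤ c * ‖g x‖ₑ) :
    eLpNorm f P μ ≤ c * eLpNorm g P μ := by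
  have := eLpNorm_le_nnreal_smul_eLpNorm_of_ae_le_mul' h P
  rwa [ENNReal.smul_def, smul_eq_mul] at this

lemma eLp_avg {α β : Type*} [MeasurableSpace α] [MeasurableSpace β] (μ : Measure α) [SFinite μ]
    (ν : Measure β) [IsFiniteMeasure ν] (P : ℝ≥0∞) (h1 : 1 ≤ P) (hT : P ≠ ⊤)
    (K : α → β → ℝ≥0∞) (hK : Measurable (Function.uncurry K)) (M : ℝ≥0∞)
    (h : ∀ᵐ t ∂ν, eLpNorm (fun x => K x t) P μ ≤ M) :
    eLpNorm (fun x => ∫⁻ t, K x t ∂ν) P μ ≤ ν Set.univ * M := by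
  have hP0 : P ≠ 0 := (zero_lt_one.trans_le h1).ne'
  have hp0 : 0 < P.toReal := ENNReal.toReal_pos hP0 hT
  have hp1 : 1 ≤ P.toReal := by
    have := ENNReal.toReal_mono hT h1
    simpa using this
  set p := P.toReal with hp
  rcases eq_or_ne (ν Set.univ) 0 with h0 | h0
  · rw [Measure.measure_univ_eq_zero] at h0
    subst h0
    simp
  have hx : ∀ x, (∫⁻ t, K x t ∂ν) ^ p ≤ ν Set.univ ^ (p - 1) * ∫⁻ t, K x t ^ p ∂ν := by
    intro x
    have hm : Measurable (K x) := hK.comp measurable_prodMk_left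
    have := eLpNorm_le_eLpNorm_mul_rpow_measure_univ (μ := ν) (f := K x) h1
      hm.aestronglyMeasurable
    rw [eLpNorm_one_eq_lintegral_enorm, eLpNorm_eq_lintegral_rpow_enorm_toReal hP0 hT] at this
    simp only [enorm_eq_self] at this
    have h2 := ENNReal.rpow_le_rpow this hp0.le
    refine h2.trans_eq ?_
    rw [ENNReal.mul_rpow_of_nonneg _ _ hp0.le, ← ENNReal.rpow_mul, ← ENNReal.rpow_mul,
      one_div_mul_cancel hp0.ne', ENNReal.rpow_one, mul_comm]
    congr 2
    rw [ENNReal.toReal_one, ← hp]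
    field_simp
  rw [eLpNorm_eq_lintegral_rpow_enorm_toReal hP0 hT]
  simp only [enorm_eq_self]
  rw [← hp]
  have hM : ∀ᵐ t ∂ν, ∫⁻ x, K x t ^ p ∂μ ≤ M ^ p := by
    filter_upwards [h] with t ht
    rw [eLpNorm_eq_lintegral_rpow_enorm_toReal hP0 hT] at ht
    simp only [enorm_eq_self] at ht
    have := ENNReal.rpow_le_rpow ht hp0.le
    rwa [← ENNReal.rpow_mul, one_div_mul_cancel hp0.ne', ENNReal.rpow_one] at this
  have : ∫⁻ x, (∫⁻ t, K x t ∂ν) ^ p ∂μ ≤ (ν Set.univ * M) ^ p := by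
    calc ∫⁻ x, (∫⁻ t, K x t ∂ν) ^ p ∂μ ≤ ∫⁻ x, ν Set.univ ^ (p - 1) * ∫⁻ t, K x t ^ p ∂ν ∂μ :=
          lintegral_mono hx
      _ = ν Set.univ ^ (p - 1) * ∫⁻ x, ∫⁻ t, K x t ^ p ∂ν ∂μ := by
          rw [lintegral_const_mul]
          exact (hK.pow_const p).lintegral_prod_right'
      _ = ν Set.univ ^ (p - 1) * ∫⁻ t, ∫⁻ x, K x t ^ p ∂μ ∂ν := by
          rw [lintegral_lintegral_swap]
          exact (hK.pow_const p).aemeasurable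
      _ ≤ ν Set.univ ^ (p - 1) * ∫⁻ t, M ^ p ∂ν := by
          gcongr 1
          exact lintegral_mono_ae hM
      _ = (ν Set.univ * M) ^ p := by
          rw [lintegral_const, ENNReal.mul_rpow_of_nonneg _ _ hp0.le, mul_comm (M ^ p), ← mul_assoc]
          congr 1
          nth_rewrite 2 [← ENNReal.rpow_one (ν Set.univ)]
          rw [← ENNReal.rpow_add _ _ h0 (measure_ne_top _ _)]
          congr 1; ring
  have := ENNReal.rpow_le_rpow this (one_div_nonneg.2 hp0.le)
  rwa [← ENNReal.rpow_mul, mul_one_div_cancel hp0.ne', ENNReal.rpow_one] at this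

lemma eLp_split {α : Type*} [MeasurableSpace α] (μ : Measure α) (P : ℝ≥0∞) (h1 : 1 ≤ P)
    (f : α → ℝ) (hf : Measurable f) (s : Set α) (hs : MeasurableSet s) :
    eLpNorm f P μ ≤ eLpNorm f P (μ.restrict s) + eLpNorm f P (μ.restrict sᶜ) := by
  rw [← eLpNorm_indicator_eq_eLpNorm_restrict hs, ← eLpNorm_indicator_eq_eLpNorm_restrict hs.compl]
  conv_lhs => rw [← Set.indicator_self_add_compl s f]
  exact eLpNorm_add_le (hf.indicator hs).aestronglyMeasurable
    (hf.indicator hs.compl).aestronglyMeasurable h1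

lemma map_affine_le {N : ℕ} (a : Euc N) (c : ℝ) (hc : 1 ≤ |c|) :
    Measure.map (fun x : Euc N => a + c • x) volume ≤ volume := by
  have hc0 : c ≠ 0 := by rintro rfl; simp at hc; linarith
  have : (fun x : Euc N => a + c • x) = (fun x => a + x) ∘ (fun x => c • x) := rfl
  rw [this, ← Measure.map_map (measurable_const_add a) (measurable_const_smul c),
    Measure.map_addHaar_smul _ hc0, Measure.map_smul, map_add_left_eq_self]
  have h2 : ENNReal.ofReal |(c ^ Module.finrank ℝ (Euc N))⁻¹| ≤ 1 := by
    rw [ENNReal.ofReal_le_one, abs_inv, abs_pow]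
    exact inv_le_one_of_one_le₀ (one_le_pow₀ hc)
  intro S
  simp only [Measure.smul_apply, smul_eq_mul]
  exact mul_le_of_le_one_left' h2

lemma eLp_affine {N : ℕ} {ε : Type*} [TopologicalSpace ε] [ContinuousENorm ε] (a : Euc N) (c : ℝ)
    (hc : 1 ≤ |c|) (P : ℝ≥0∞) (F : Euc N → ε) (hF : StronglyMeasurable F) :
    eLpNorm (fun x => F (a + c • x)) P volume ≤ eLpNorm F P volume := by
  have hm : Measurable (fun x : Euc N => a + c • x) := (measurable_const_smul c).const_add a
  have := eLpNorm_map_measure (μ := (volume : Measure (Euc N))) (p := P)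
    (f := fun x : Euc N => a + c • x) (g := F) hF.aestronglyMeasurable hm.aemeasurable
  rw [show (fun x => F (a + c • x)) = F ∘ (fun x : Euc N => a + c • x) from rfl, ← this]
  exact eLpNorm_mono_measure _ (map_affine_le a c hc)

/-- The dilation invariant measure on the exterior of the unit ball. -/
def muA (N : ℕ) : Measure (Euc N) :=
  (volume.restrict {x : Euc N | 1 ≤ ‖x‖}).withDensity fun x => ENNReal.ofReal (‖x‖ ^ (-(N : ℝ)))

lemma measA (N : ℕ) (t : ℝ) : MeasurableSet {x : Euc N | t ≤ ‖x‖} :=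
  measurableSet_le measurable_const measurable_norm

lemma dens_meas (N : ℕ) : Measurable fun x : Euc N => ENNReal.ofReal (‖x‖ ^ (-(N : ℝ))) :=
  (measurable_norm.pow_const _).ennreal_ofReal

instance (N : ℕ) : SFinite (muA N) := by unfold muA; infer_instance

lemma muA_ae (N : ℕ) : ∀ᵐ x ∂muA N, 1 ≤ ‖x‖ := by
  have h : ∀ᵐ x ∂(volume.restrict {x : Euc N | 1 ≤ ‖x‖}), 1 ≤ ‖x‖ :=
    ae_restrict_mem (measA N 1)
  exact (withDensity_absolutelyContinuous _ _).ae_le h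

lemma muA_map (N : ℕ) (t : ℝ) (ht : 1 ≤ t) :
    Measure.map (fun x : Euc N => t • x) (muA N) = (muA N).restrict {x | t ≤ ‖x‖} := by
  have ht0 : 0 < t := by linarith
  have hm : Measurable (fun x : Euc N => t • x) := measurable_const_smul t
  ext S hS
  rw [Measure.map_apply hm hS, Measure.restrict_apply hS]
  set B := S ∩ {x : Euc N | t ≤ ‖x‖} with hB
  have hBm : MeasurableSet B := hS.inter (measA N t)
  unfold muA
  rw [withDensity_apply _ (hm hS), withDensity_apply _ hBm, Measure.restrict_restrict (hm hS),
    Measure.restrict_restrict hBm]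
  have e1 : (fun x : Euc N => t • x) ⁻¹' S ∩ {x | 1 ≤ ‖x‖} = (fun x : Euc N => t • x) ⁻¹' B := by
    ext x
    simp only [hB, Set.mem_inter_iff, Set.mem_preimage, Set.mem_ofPred_eq, norm_smul,
      Real.norm_eq_abs, abs_of_pos ht0]
    constructor
    · rintro ⟨h1, h2⟩; exact ⟨h1, by nlinarith⟩
    · rintro ⟨h1, h2⟩; exact ⟨h1, by nlinarith⟩
  have e2 : B ∩ {x : Euc N | 1 ≤ ‖x‖} = B := by
    apply Set.inter_eq_left.2
    rintro x ⟨_, hx⟩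
    exact ht.trans hx
  rw [e1, e2]
  have e3 : ∀ x : Euc N, ENNReal.ofReal (‖x‖ ^ (-(N : ℝ))) =
      ENNReal.ofReal (t ^ (N : ℝ)) * ENNReal.ofReal (‖t • x‖ ^ (-(N : ℝ))) := by
    intro x
    rw [← ENNReal.ofReal_mul (by positivity), norm_smul, Real.norm_eq_abs, abs_of_pos ht0,
      Real.mul_rpow ht0.le (norm_nonneg _), ← mul_assoc, ← Real.rpow_add ht0]
    simp
  rw [lintegral_congr (μ := (volume : Measure (Euc N)).restrict
    ((fun x : Euc N => t • x) ⁻¹' B)) e3]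
  have h5 := setLIntegral_map (μ := (volume : Measure (Euc N))) hBm (dens_meas N) hm
  have hcm : Measurable fun x : Euc N => ENNReal.ofReal (‖t • x‖ ^ (-(N : ℝ))) :=
    (dens_meas N).comp hm
  rw [lintegral_const_mul _ hcm, ← h5, Measure.map_addHaar_smul _ ht0.ne',
    Measure.restrict_smul, lintegral_smul_measure, smul_eq_mul, ← mul_assoc,
    ← ENNReal.ofReal_mul (by positivity)]
  have : t ^ (N : ℝ) * |(t ^ Module.finrank ℝ (Euc N))⁻¹| = 1 := by
    rw [abs_of_pos (by positivity)]
    simp [ht0.ne']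
  rw [this]; simp

lemma eLp_dil {N : ℕ} {ε : Type*} [TopologicalSpace ε] [ContinuousENorm ε] (t : ℝ) (ht : 1 ≤ t)
    (P : ℝ≥0∞) (F : Euc N → ε) (hF : StronglyMeasurable F) :
    eLpNorm (fun x => F (t • x)) P (muA N) ≤ eLpNorm F P (muA N) := by
  have hm : Measurable (fun x : Euc N => t • x) := measurable_const_smul t
  have := eLpNorm_map_measure (μ := muA N) (p := P)
    (f := fun x : Euc N => t • x) (g := F) hF.aestronglyMeasurable hm.aemeasurable
  rw [show (fun x => F (t • x)) = F ∘ (fun x : Euc N => t • x) from rfl, ← this, muA_map N t ht]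
  exact eLpNorm_mono_measure _ Measure.restrict_le_self

/-- The smooth-at-infinity radial weight `max 1 |x|`. -/
def rr {N : ℕ} (x : Euc N) : ℝ := max 1 ‖x‖

lemma rr_one_le {N : ℕ} (x : Euc N) : 1 ≤ rr x := le_max_left _ _
lemma rr_pos {N : ℕ} (x : Euc N) : 0 < rr x := zero_lt_one.trans_le (rr_one_le x)
lemma rr_eq {N : ℕ} (x : Euc N) (hx : 1 ≤ ‖x‖) : rr x = ‖x‖ := max_eq_right hx
lemma rr_cont {N : ℕ} : Continuous (rr : Euc N → ℝ) := continuous_const.max continuous_norm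
lemma rr_pow_cont {N : ℕ} (a : ℝ) : Continuous (fun x : Euc N => rr x ^ a) :=
  rr_cont.rpow_const fun x => Or.inl (rr_pos x).ne'

lemma rr_smul {N : ℕ} (x : Euc N) (hx : 1 ≤ ‖x‖) (t : ℝ) (ht : 1 ≤ t) : rr (t • x) = t * rr x := by
  have : ‖t • x‖ = t * ‖x‖ := by rw [norm_smul, Real.norm_eq_abs, abs_of_pos (by linarith)]
  rw [rr_eq x hx, rr_eq _ (by rw [this]; nlinarith), this]

/-- Passing from the invariant measure to Lebesgue measure. -/
lemma eLp_muA {N : ℕ} (P : ℝ≥0∞) (h1 : 1 ≤ P) (hT : P ≠ ⊤) (a : ℝ) (f : Euc N → ℝ) :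
    eLpNorm (fun x => rr x ^ a * f x) P (muA N) =
      eLpNorm (fun x => rr x ^ (a - N / P.toReal) * f x) P
        (volume.restrict {x : Euc N | 1 ≤ ‖x‖}) := by
  have hP0 : P ≠ 0 := (zero_lt_one.trans_le h1).ne'
  have hp0 : 0 < P.toReal := ENNReal.toReal_pos hP0 hT
  rw [eLpNorm_eq_lintegral_rpow_enorm_toReal hP0 hT, eLpNorm_eq_lintegral_rpow_enorm_toReal hP0 hT]
  congr 1
  unfold muA
  rw [lintegral_withDensity_eq_lintegral_mul_non_measurable _ (dens_meas N) (by simp)]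
  refine lintegral_congr_ae ?_
  filter_upwards [ae_restrict_mem (measA N 1)] with x hx
  have hx : 1 ≤ ‖x‖ := hx
  have hr := rr_pos x
  simp only [Pi.mul_apply, enorm_mul]
  rw [ENNReal.mul_rpow_of_nonneg _ _ hp0.le, ENNReal.mul_rpow_of_nonneg _ _ hp0.le, ← mul_assoc]
  congr 1
  rw [← rr_eq x hx, Real.enorm_of_nonneg (by positivity), Real.enorm_of_nonneg (by positivity),
    ENNReal.ofReal_rpow_of_nonneg (by positivity) hp0.le,
    ENNReal.ofReal_rpow_of_nonneg (by positivity) hp0.le, ← ENNReal.ofReal_mul (by positivity),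
    ← Real.rpow_mul hr.le, ← Real.rpow_mul hr.le, ← Real.rpow_add hr]
  congr 2
  field_simp
  ring

lemma eLp_lim_le {α : Type*} [MeasurableSpace α] {μ : Measure α} {P B : ℝ≥0∞} (f : ℕ → α → ℝ)
    (g : α → ℝ) (hf : ∀ n, AEStronglyMeasurable (f n) μ)
    (h : ∀ᵐ x ∂μ, Tendsto (fun n => f n x) atTop (𝓝 (g x))) (hB : ∀ n, eLpNorm (f n) P μ ≤ B) :
    eLpNorm g P μ ≤ B := by
  refine (Lp.eLpNorm_lim_le_liminf_eLpNorm hf g h).trans ?_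
  exact liminf_le_of_frequently_le' (Frequently.of_forall hB)

lemma absorb (n n0 w : ℝ≥0∞) (a : ℝ) (ha0 : 0 ≤ a) (ha : a < 1) (hn : n ≠ ⊤)
    (h : n ≤ n0 + ENNReal.ofReal a * (n + w)) :
    n ≤ (Real.toNNReal (1 - a)⁻¹ : NNReal) * (w + n0) := by
  have hc : (Real.toNNReal (1 - a)⁻¹ : NNReal) ≠ 0 := by
    have : 0 < (1 - a)⁻¹ := inv_pos.2 (by linarith)
    simpa using this
  rcases eq_or_ne w ⊤ with rfl | hw
  · rw [top_add, ENNReal.mul_top (by exact_mod_cast hc)]; exact le_top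
  rcases eq_or_ne n0 ⊤ with rfl | hn0
  · rw [add_top, ENNReal.mul_top (by exact_mod_cast hc)]; exact le_top
  lift n to NNReal using hn
  lift w to NNReal using hw
  lift n0 to NNReal using hn0
  have ha' : ENNReal.ofReal a = (Real.toNNReal a : NNReal) := rfl
  rw [ha'] at h
  norm_cast at h ⊢
  have h' : (n : ℝ) ≤ n0 + a * (n + w) := by
    have := NNReal.coe_le_coe.2 h
    push_cast at this
    rwa [Real.coe_toNNReal _ ha0] at this
  rw [← NNReal.coe_le_coe]
  push_cast
  rw [Real.coe_toNNReal _ (by rw [inv_nonneg]; linarith), inv_mul_eq_div, le_div_iff₀ (by linarith)]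
  have : a * (w : ℝ) ≤ w := mul_le_of_le_one_left w.2 ha.le
  linarith

lemma hardy_lt {N : ℕ} (P : ℝ≥0∞) (h1 : 1 ≤ P) (θ δ : ℝ) (hθ0 : 0 ≤ θ) (hθ : θ < 1)
    (hδ : θ * 2 ^ δ < 1) (V W : Euc N → ℝ) (hV : Measurable V) (hWm : Measurable W)
    (hW : ∀ x, 1 ≤ ‖x‖ → W x = V x - θ * V ((2 : ℝ) • x))
    (hfin : eLpNorm (fun x => rr x ^ (-δ) * V x) 1 (muA N) ≠ ⊤) :
    eLpNorm V P (muA N) ≤ (Real.toNNReal (1 - θ)⁻¹ : NNReal) * eLpNorm W P (muA N) := by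
  have hp2 : ∀ j : ℕ, (1 : ℝ) ≤ 2 ^ j := fun j => one_le_pow₀ (by norm_num)
  have hcomp : ∀ (j : ℕ) (F : Euc N → ℝ), Measurable F →
      Measurable fun x : Euc N => F ((2 : ℝ) ^ j • x) := fun j F hF =>
    hF.comp (measurable_const_smul ((2 : ℝ) ^ j))
  let S : ℕ → Euc N → ℝ := fun J x => ∑ i ∈ Finset.range J, θ ^ i * W ((2 : ℝ) ^ i • x)
  let R : ℕ → Euc N → ℝ := fun J x => θ ^ J * V ((2 : ℝ) ^ J • x)
  have hSm : ∀ J, Measurable (S J) := fun J =>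
    Finset.measurable_fun_sum _ fun i _ => (hcomp i W hWm).const_mul _
  have hRm : ∀ J, Measurable (R J) := fun J => (hcomp J V hV).const_mul _
  have hVS : ∀ J, ∀ x, 1 ≤ ‖x‖ → V x = S J x + R J x := by
    intro J x hx
    induction J with
    | zero => simp [S, R]
    | succ J ih =>
      have hx' : 1 ≤ ‖(2 : ℝ) ^ J • x‖ := by
        rw [norm_smul, Real.norm_eq_abs, abs_of_pos (by positivity)]
        nlinarith [hp2 J]
      rw [ih]
      simp only [S, R, Finset.sum_range_succ]
      rw [hW _ hx', smul_smul, ← pow_succ']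
      ring
  have hSb : ∀ J, eLpNorm (S J) P (muA N) ≤
      (Real.toNNReal (1 - θ)⁻¹ : NNReal) * eLpNorm W P (muA N) := by
    intro J
    have e : S J = ∑ i ∈ Finset.range J, fun x => θ ^ i * W ((2 : ℝ) ^ i • x) := by
      ext x; simp [S]
    rw [e]
    refine (eLpNorm_sum_le (fun i _ => ((hcomp i W hWm).const_mul _).aestronglyMeasurable) h1).trans ?_
    calc ∑ i ∈ Finset.range J, eLpNorm (fun x => θ ^ i * W ((2 : ℝ) ^ i • x)) P (muA N)
        ≤ ∑ i ∈ Finset.range J, ((Real.toNNReal θ ^ i : NNReal) : ℝ≥0∞) * eLpNorm W P (muA N) := by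
          refine Finset.sum_le_sum fun i _ => ?_
          refine (eLp_le_mul (g := fun x => W ((2 : ℝ) ^ i • x)) (Real.toNNReal θ ^ i)
            (Eventually.of_forall fun x => ?_)).trans ?_
          · rw [enorm_mul, Real.enorm_of_nonneg (by positivity), ENNReal.ofReal_pow hθ0]
            push_cast
            rfl
          · gcongr
            exact eLp_dil _ (hp2 i) P W hWm.stronglyMeasurable
      _ = ((∑ i ∈ Finset.range J, Real.toNNReal θ ^ i : NNReal) : ℝ≥0∞) * eLpNorm W P (muA N) := by
          rw [← Finset.sum_mul]; push_cast; rfl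
      _ ≤ _ := by
          gcongr
          rw [← NNReal.coe_le_coe]
          push_cast
          rw [Real.coe_toNNReal _ hθ0, Real.coe_toNNReal _ (by rw [inv_nonneg]; linarith),
            ← tsum_geometric_of_lt_one hθ0 hθ]
          exact (summable_geometric_of_lt_one hθ0 hθ).sum_le_tsum _ fun i _ => by positivity
  let Z : ℕ → Euc N → ℝ := fun J x => rr x ^ (-δ) * R J x
  have hZm : ∀ J, AEStronglyMeasurable (Z J) (muA N) := fun J =>
    ((rr_pow_cont (-δ)).measurable.mul (hRm J)).aestronglyMeasurable
  set M := eLpNorm (fun x => rr x ^ (-δ) * V x) 1 (muA N) with hM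
  have hZb : ∀ J, eLpNorm (Z J) 1 (muA N) ≤ ((Real.toNNReal (θ * 2 ^ δ) ^ J : NNReal) : ℝ≥0∞) * M := by
    intro J
    refine (eLp_le_mul (g := fun x => (fun z => rr z ^ (-δ) * V z) ((2 : ℝ) ^ J • x))
      (Real.toNNReal (θ * 2 ^ δ) ^ J) ?_).trans ?_
    · filter_upwards [muA_ae N] with x hx
      simp only [Z, R]
      rw [rr_smul x hx _ (hp2 J), Real.mul_rpow (by positivity) (rr_pos x).le]
      have e : rr x ^ (-δ) * (θ ^ J * V ((2 : ℝ) ^ J • x)) =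
          (θ * 2 ^ δ) ^ J * ((2 ^ J) ^ (-δ) * rr x ^ (-δ) * V ((2 : ℝ) ^ J • x)) := by
        have e2 : ((2 : ℝ) ^ δ) ^ J * ((2 : ℝ) ^ J) ^ (-δ) = 1 := by
          rw [← Real.rpow_natCast (2 ^ δ) J, ← Real.rpow_mul (by norm_num),
            ← Real.rpow_natCast 2 J, ← Real.rpow_mul (by norm_num), ← Real.rpow_add (by norm_num)]
          ring_nf; simp
        rw [mul_pow]
        linear_combination (-(rr x ^ (-δ) * (θ ^ J * V ((2 : ℝ) ^ J • x)))) * e2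
      rw [e, enorm_mul, Real.enorm_of_nonneg (by positivity), ENNReal.ofReal_pow (by positivity)]
      push_cast
      rfl
    · gcongr
      exact eLp_dil _ (hp2 J) 1 (fun z => rr z ^ (-δ) * V z)
        ((rr_pow_cont (-δ)).measurable.mul hV).stronglyMeasurable
  have hZt : Tendsto (fun J => eLpNorm (Z J - 0) 1 (muA N)) atTop (𝓝 0) := by
    have hg : Tendsto (fun J : ℕ => ((Real.toNNReal (θ * 2 ^ δ) ^ J : NNReal) : ℝ≥0∞) * M)
        atTop (𝓝 (0 * M)) := by
      refine ENNReal.Tendsto.mul_const ?_ (Or.inr hfin)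
      rw [← ENNReal.coe_zero, ENNReal.tendsto_coe]
      apply NNReal.tendsto_pow_atTop_nhds_zero_of_lt_one
      rw [← NNReal.coe_lt_coe, Real.coe_toNNReal _ (by positivity)]
      exact hδ
    rw [zero_mul] at hg
    refine tendsto_of_tendsto_of_tendsto_of_le_of_le tendsto_const_nhds hg (fun _ => zero_le) ?_
    intro J
    simpa using hZb J
  obtain ⟨ns, -, hns⟩ := (tendstoInMeasure_of_tendsto_eLpNorm one_ne_zero hZm
    (aestronglyMeasurable_const (b := (0:ℝ))) hZt).exists_seq_tendsto_ae
  refine eLp_lim_le (fun j => S (ns j)) V (fun j => (hSm _).aestronglyMeasurable) ?_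
    (fun j => hSb _)
  filter_upwards [hns, muA_ae N] with x hx hx1
  have h3 : Tendsto (fun j => V x - rr x ^ δ * Z (ns j) x) atTop (𝓝 (V x - rr x ^ δ * 0)) :=
    tendsto_const_nhds.sub (tendsto_const_nhds.mul hx)
  rw [mul_zero, sub_zero] at h3
  refine h3.congr fun j => ?_
  simp only [Z]
  rw [← mul_assoc, ← Real.rpow_add (rr_pos x), hVS (ns j) x hx1]
  simp

lemma hardy_gt {N : ℕ} (P : ℝ≥0∞) (h1 : 1 ≤ P) (θ : ℝ) (hθ : 1 < θ)
    (V W : Euc N → ℝ) (hV : Measurable V) (hWm : Measurable W)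
    (hW : ∀ x, 1 ≤ ‖x‖ → W x = V x - θ * V ((2 : ℝ) • x))
    (hfin : ∀ R, eLpNorm V P ((muA N).restrict (ball 0 R)) ≠ ⊤) :
    eLpNorm V P (muA N) ≤ (Real.toNNReal (1 - θ⁻¹)⁻¹ : NNReal) *
      (eLpNorm W P (muA N) + eLpNorm V P ((muA N).restrict (ball 0 2))) := by
  have hθ0 : 0 < θ := by linarith
  have hm : Measurable (fun x : Euc N => (2 : ℝ) • x) := measurable_const_smul 2
  have key : ∀ R, 1 ≤ R → eLpNorm V P ((muA N).restrict (ball 0 R)) ≤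
      (Real.toNNReal (1 - θ⁻¹)⁻¹ : NNReal) *
      (eLpNorm W P (muA N) + eLpNorm V P ((muA N).restrict (ball 0 2))) := by
    intro R hR
    refine absorb _ _ _ _ (by positivity) (inv_lt_one_of_one_lt₀ hθ) (hfin R) ?_
    have hsub : eLpNorm V P ((muA N).restrict (ball 0 R)) ≤
        eLpNorm V P ((muA N).restrict (ball 0 (2 * R))) :=
      eLpNorm_mono_measure _ (Measure.restrict_mono (ball_subset_ball (by linarith)) le_rfl)
    refine hsub.trans ((eLp_split _ P h1 V hV (ball 0 2) measurableSet_ball).trans ?_)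
    gcongr
    · exact Measure.restrict_le_self
    · have e1 : (((muA N).restrict (ball 0 (2 * R))).restrict (ball 0 2)ᶜ) =
          Measure.map (fun x : Euc N => (2 : ℝ) • x) ((muA N).restrict (ball 0 R)) := by
        have e2 : (fun x : Euc N => (2 : ℝ) • x) ⁻¹' (ball 0 (2 * R)) = ball 0 R := by
          ext x
          simp [norm_smul]
        rw [← e2, ← Measure.restrict_map hm measurableSet_ball, muA_map N 2 (by norm_num),
          Measure.restrict_restrict measurableSet_ball,
          Measure.restrict_restrict measurableSet_ball.compl, Set.inter_comm]
        congr 2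
        ext x
        simp
      rw [e1, eLpNorm_map_measure hV.aestronglyMeasurable hm.aemeasurable]
      refine (eLp_le_mul (g := V - W) (Real.toNNReal θ⁻¹) ?_).trans ?_
      · filter_upwards [ae_restrict_of_ae (muA_ae N)] with x hx
        have : (V ∘ fun x => (2 : ℝ) • x) x = θ⁻¹ * (V - W) x := by
          simp only [Function.comp, Pi.sub_apply]
          rw [hW x hx]; field_simp; ring
        rw [this, enorm_mul, Real.enorm_of_nonneg (by positivity)]
        rfl
      · refine mul_le_mul' le_rfl ?_
        refine (eLpNorm_sub_le hV.aestronglyMeasurable hWm.aestronglyMeasurable h1).trans ?_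
        gcongr
        exact Measure.restrict_le_self
  refine eLp_lim_le (fun j : ℕ => (ball (0 : Euc N) (j + 1)).indicator V) V
    (fun j => (hV.indicator measurableSet_ball).aestronglyMeasurable) ?_ (fun j => ?_)
  · refine Eventually.of_forall fun x => ?_
    refine tendsto_const_nhds.congr' ?_
    filter_upwards [eventually_ge_atTop (⌈‖x‖⌉₊)] with j hj
    rw [Set.indicator_of_mem]
    rw [mem_ball_zero_iff]
    have := Nat.le_ceil ‖x‖
    have h2 : ((⌈‖x‖⌉₊ : ℕ) : ℝ) ≤ j := by exact_mod_cast hj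
    linarith
  · rw [eLpNorm_indicator_eq_eLpNorm_restrict measurableSet_ball]
    exact key _ (by have : (0:ℝ) ≤ j := Nat.cast_nonneg j
                    linarith)

lemma muA_le (N : ℕ) : muA N ≤ volume := by
  have h : muA N ≤ (volume.restrict {x : Euc N | 1 ≤ ‖x‖}).withDensity 1 := by
    unfold muA
    refine withDensity_mono ?_
    filter_upwards [ae_restrict_mem (measA N 1)] with x hx
    have hx : 1 ≤ ‖x‖ := hx
    simp only [Pi.one_apply, ENNReal.ofReal_le_one]
    exact Real.rpow_le_one_of_one_le_of_nonpos hx (by simp)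
  rw [withDensity_one] at h
  exact h.trans Measure.restrict_le_self

lemma eLp_affine_restrict {N : ℕ} {ε : Type*} [TopologicalSpace ε] [ContinuousENorm ε] (a : Euc N)
    (c : ℝ) (hc : 1 ≤ |c|) (P : ℝ≥0∞) (F : Euc N → ε) (hF : StronglyMeasurable F)
    (s S : Set (Euc N)) (hS : MeasurableSet S) (hs : ∀ x ∈ s, a + c • x ∈ S) :
    eLpNorm (fun x => F (a + c • x)) P (volume.restrict s) ≤ eLpNorm F P (volume.restrict S) := by
  have hm : Measurable (fun x : Euc N => a + c • x) := (measurable_const_smul c).const_add a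
  have h1 : eLpNorm (fun x => F (a + c • x)) P (volume.restrict s) ≤
      eLpNorm (fun x => F (a + c • x)) P
        (volume.restrict ((fun x : Euc N => a + c • x) ⁻¹' S)) :=
    eLpNorm_mono_measure _ (Measure.restrict_mono hs le_rfl)
  refine h1.trans ?_
  have := eLpNorm_map_measure (μ := volume.restrict ((fun x : Euc N => a + c • x) ⁻¹' S)) (p := P)
    (f := fun x : Euc N => a + c • x) (g := F) hF.aestronglyMeasurable hm.aemeasurable
  rw [show (fun x => F (a + c • x)) = F ∘ (fun x : Euc N => a + c • x) from rfl, ← this,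
    ← Measure.restrict_map hm hS]
  exact eLpNorm_mono_measure _ (Measure.restrict_mono_measure (map_affine_le a c hc) _)

lemma enorm_real_mul_le (a : ℝ) (C : ℝ) (ha0 : 0 ≤ a) (ha : a ≤ C) (b : ℝ) :
    ‖a * b‖ₑ ≤ (Real.toNNReal C : NNReal) * ‖b‖ₑ := by
  rw [enorm_mul, Real.enorm_of_nonneg ha0]
  gcongr
  exact ENNReal.ofReal_le_ofReal ha

lemma loc_EE {N : ℕ} (P : ℝ≥0∞) (h1 : 1 ≤ P) (n : ℕ) (c : ℝ) : ∃ C : NNReal,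
    ∀ (v : Euc N → ℝ), Continuous v → ∀ R, 0 ≤ R →
    eLpNorm (EE n c v) P (volume.restrict (ball 0 R)) ≤
      C * eLpNorm v P (volume.restrict (ball 0 (2 ^ n * R))) := by
  induction n generalizing c with
  | zero => exact ⟨1, fun v _ R _ => by simp [EE]⟩
  | succ n ih =>
    obtain ⟨C, hC⟩ := ih (c + 1)
    refine ⟨C + Real.toNNReal (2 ^ (-c)) * C, fun v hv R hR => ?_⟩
    have hX := EE_continuous n (c + 1) v hv
    have h2c : Continuous fun x : Euc N => EE n (c + 1) v ((2 : ℝ) • x) :=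
      hX.comp (continuous_const_smul _)
    have hsub : ∀ r, r ≤ 2 ^ (n + 1) * R → eLpNorm v P (volume.restrict (ball 0 r)) ≤
        eLpNorm v P (volume.restrict (ball 0 (2 ^ (n + 1) * R))) := fun r hr =>
      eLpNorm_mono_measure _ (Measure.restrict_mono (ball_subset_ball hr) le_rfl)
    refine (eLpNorm_sub_le (f := EE n (c + 1) v)
      (g := fun x => 2 ^ (-c) * EE n (c + 1) v ((2 : ℝ) • x)) hX.aestronglyMeasurable
      (continuous_const.mul h2c).aestronglyMeasurable h1).trans ?_
    rw [ENNReal.coe_add, add_mul]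
    refine add_le_add ?_ ?_
    · refine (hC v hv R hR).trans ?_
      gcongr 1
      apply hsub
      rw [pow_succ]
      nlinarith [pow_pos (two_pos (α := ℝ)) n, mul_nonneg (pow_pos (two_pos (α := ℝ)) n).le hR]
    · refine (eLp_le_mul (g := fun x => EE n (c + 1) v ((2 : ℝ) • x)) (Real.toNNReal (2 ^ (-c)))
        (Eventually.of_forall fun x => enorm_real_mul_le _ _ (by positivity) le_rfl _)).trans ?_
      rw [ENNReal.coe_mul, mul_assoc]
      refine mul_le_mul' le_rfl ?_
      have h3 := eLp_affine_restrict (0 : Euc N) 2 (by norm_num) P (EE n (c + 1) v)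
        hX.stronglyMeasurable (ball 0 R) (ball 0 (2 * R)) measurableSet_ball
        (by intro x hx; simpa [norm_smul] using hx)
      simp only [zero_add] at h3
      refine h3.trans ((hC v hv (2 * R) (by positivity)).trans ?_)
      gcongr 1
      apply hsub
      rw [pow_succ, mul_assoc]

lemma fin_EE {N : ℕ} (P : ℝ≥0∞) (h1 : 1 ≤ P) (b : ℝ) (n : ℕ) (c : ℝ)
    (v : Euc N → ℝ) (hv : Continuous v)
    (hfin : eLpNorm (fun x => rr x ^ b * v x) P (muA N) ≠ ⊤) :
    eLpNorm (fun x => rr x ^ b * EE n c v x) P (muA N) ≠ ⊤ := by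
  induction n generalizing c with
  | zero => exact hfin
  | succ n ih =>
    have hX := EE_continuous n (c + 1) v hv
    have h2c : Continuous fun x : Euc N => EE n (c + 1) v ((2 : ℝ) • x) :=
      hX.comp (continuous_const_smul _)
    have hY : Continuous fun x : Euc N => rr x ^ b * EE n (c + 1) v x := (rr_pow_cont b).mul hX
    have e : (fun x : Euc N => rr x ^ b * EE (n + 1) c v x) =
        (fun x => rr x ^ b * EE n (c + 1) v x) -
          fun x => rr x ^ b * (2 ^ (-c) * EE n (c + 1) v ((2 : ℝ) • x)) := by
      ext x; simp only [EE, TT, Pi.sub_apply]; ring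
    rw [e]
    refine ((eLpNorm_sub_le hY.aestronglyMeasurable
      ((rr_pow_cont b).mul (continuous_const.mul h2c)).aestronglyMeasurable h1).trans_lt ?_).ne
    refine ENNReal.add_lt_top.2 ⟨(ih (c + 1)).lt_top, ?_⟩
    refine (eLp_le_mul (g := fun x => (fun z => rr z ^ b * EE n (c + 1) v z) ((2 : ℝ) • x))
      (Real.toNNReal (2 ^ (-b) * 2 ^ (-c))) ?_).trans_lt ?_
    · filter_upwards [muA_ae N] with x hx
      change ‖rr x ^ b * (2 ^ (-c) * EE n (c + 1) v ((2 : ℝ) • x))‖ₑ ≤ _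
      rw [rr_smul x hx 2 (by norm_num), Real.mul_rpow (by norm_num) (rr_pos x).le]
      have e2 : (2 : ℝ) ^ (-b) * 2 ^ b = 1 := by rw [← Real.rpow_add (by norm_num)]; simp
      have : rr x ^ b * (2 ^ (-c) * EE n (c + 1) v ((2 : ℝ) • x)) =
          (2 ^ (-b) * 2 ^ (-c)) * (2 ^ b * rr x ^ b * EE n (c + 1) v ((2 : ℝ) • x)) := by
        linear_combination (-(rr x ^ b * (2 ^ (-c) * EE n (c + 1) v ((2 : ℝ) • x)))) * e2
      rw [this]
      exact enorm_real_mul_le _ _ (by positivity) le_rfl _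
    · refine ENNReal.mul_lt_top ENNReal.coe_lt_top ?_
      exact (eLp_dil 2 (by norm_num) P _ hY.stronglyMeasurable).trans_lt (ih (c + 1)).lt_top

lemma rr_pow_le {N : ℕ} (a R : ℝ) (hR : 1 ≤ R) (x : Euc N) (hx : ‖x‖ ≤ R) :
    rr x ^ a ≤ R ^ |a| := by
  have h : rr x ≤ R := max_le hR hx
  calc rr x ^ a ≤ rr x ^ |a| := Real.rpow_le_rpow_of_exponent_le (rr_one_le x) (le_abs_self a)
    _ ≤ R ^ |a| := Real.rpow_le_rpow (rr_pos x).le h (abs_nonneg a)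

lemma cont_loc_fin {N : ℕ} (P : ℝ≥0∞) (V : Euc N → ℝ) (hV : Continuous V) (R : ℝ) :
    eLpNorm V P (volume.restrict (ball 0 R)) ≠ ⊤ := by
  have h := (isCompact_closedBall (0 : Euc N) R).exists_bound_of_continuousOn hV.continuousOn
  obtain ⟨C, hC⟩ := h
  have hfm : IsFiniteMeasure (volume.restrict (ball (0 : Euc N) R)) :=
    ⟨by simpa using measure_ball_lt_top⟩
  refine (MemLp.of_bound hV.aestronglyMeasurable C ?_).2.ne
  filter_upwards [ae_restrict_mem measurableSet_ball] with x hx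
  exact hC x (ball_subset_closedBall hx)

lemma hardy_chain {N : ℕ} (P : ℝ≥0∞) (h1 : 1 ≤ P) (τ δ : ℝ) (n : ℕ) (c : ℝ)
    (hc : ∀ j : ℕ, j < n → τ - (c + j) ≠ 0 ∧ (τ - (c + j) < 0 → τ - (c + j) + δ < 0)) :
    ∃ C : NNReal, ∀ v : Euc N → ℝ, Continuous v →
      eLpNorm (fun x => rr x ^ (-τ - δ) * v x) 1 (muA N) ≠ ⊤ →
      eLpNorm (fun x => rr x ^ (-τ) * v x) P (muA N) ≤
        C * (eLpNorm (fun x => rr x ^ (-τ) * EE n c v x) P (muA N) +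
          eLpNorm v P (volume.restrict (ball 0 (2 ^ n)))) := by
  induction n generalizing c with
  | zero => exact ⟨1, fun v _ _ => by simp [EE]⟩
  | succ n ih =>
    obtain ⟨C, hC⟩ := ih (c + 1) (fun j hj => by
      have := hc (j + 1) (by omega)
      push_cast at this
      rwa [show c + 1 + (j : ℝ) = c + (j + 1) by ring])
    obtain ⟨C1, hC1⟩ := loc_EE (N := N) P h1 n (c + 1)
    set θ : ℝ := 2 ^ (τ - c) with hθ
    have hc0 := hc 0 (by omega)
    simp only [Nat.cast_zero, add_zero] at hc0
    have step : ∃ C2 : NNReal, ∀ v : Euc N → ℝ, Continuous v →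
        eLpNorm (fun x => rr x ^ (-τ - δ) * v x) 1 (muA N) ≠ ⊤ →
        eLpNorm (fun x => rr x ^ (-τ) * EE n (c + 1) v x) P (muA N) ≤
        C2 * (eLpNorm (fun x => rr x ^ (-τ) * EE (n + 1) c v x) P (muA N) +
          eLpNorm (fun x => rr x ^ (-τ) * EE n (c + 1) v x) P ((muA N).restrict (ball 0 2))) := by
      have hWV : ∀ v : Euc N → ℝ, ∀ x, 1 ≤ ‖x‖ → rr x ^ (-τ) * EE (n + 1) c v x =
          (fun x => rr x ^ (-τ) * EE n (c + 1) v x) x -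
            θ * (fun x => rr x ^ (-τ) * EE n (c + 1) v x) ((2 : ℝ) • x) := by
        intro v x hx
        simp only [EE, TT]
        rw [rr_smul x hx 2 (by norm_num), Real.mul_rpow (by norm_num) (rr_pos x).le]
        have e2 : θ * 2 ^ (-τ) = 2 ^ (-c) := by
          rw [hθ, ← Real.rpow_add (by norm_num)]; congr 1; ring
        linear_combination (rr x ^ (-τ) * EE n (c + 1) v ((2 : ℝ) • x)) * e2
      have hcV : ∀ v : Euc N → ℝ, Continuous v →
          Continuous fun x => rr x ^ (-τ) * EE n (c + 1) v x := fun v hv =>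
        (rr_pow_cont _).mul (EE_continuous _ _ _ hv)
      have hcW : ∀ v : Euc N → ℝ, Continuous v →
          Continuous fun x => rr x ^ (-τ) * EE (n + 1) c v x := fun v hv =>
        (rr_pow_cont _).mul (EE_continuous _ _ _ hv)
      rcases lt_or_gt_of_ne hc0.1 with hneg | hpos
      · have hθ1 : θ < 1 := Real.rpow_lt_one_of_one_lt_of_neg (by norm_num) hneg
        have hθδ : θ * 2 ^ δ < 1 := by
          rw [hθ, ← Real.rpow_add (by norm_num)]
          exact Real.rpow_lt_one_of_one_lt_of_neg (by norm_num) (hc0.2 hneg)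
        refine ⟨_, fun v hv hf => (hardy_lt P h1 θ δ (by positivity) hθ1 hθδ _ _
          (hcV v hv).measurable (hcW v hv).measurable (hWV v) ?_).trans
          (mul_le_mul' le_rfl le_self_add)⟩
        have := fin_EE 1 le_rfl (-τ - δ) n (c + 1) v hv hf
        convert this using 2
        ext x
        rw [← mul_assoc, ← Real.rpow_add (rr_pos x)]
        congr 2; ring
      · have hθ1 : 1 < θ := Real.one_lt_rpow (by norm_num) hpos
        refine ⟨_, fun v hv _ => hardy_gt P h1 θ hθ1 _ _
          (hcV v hv).measurable (hcW v hv).measurable (hWV v) fun R => ?_⟩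
        exact ((eLpNorm_mono_measure _ (Measure.restrict_mono_measure (muA_le N) _)).trans_lt
          (cont_loc_fin P _ (hcV v hv) R).lt_top).ne
    obtain ⟨C2, hC2⟩ := step
    set C3 : NNReal := Real.toNNReal (2 ^ |-τ|) with hC3
    refine ⟨C * (C2 * (1 + C3 * C1) + 1), fun v hv hf => ?_⟩
    set w := eLpNorm (fun x => rr x ^ (-τ) * EE (n + 1) c v x) P (muA N) with hw
    set l := eLpNorm v P (volume.restrict (ball 0 (2 ^ (n + 1)))) with hl
    have l1 : eLpNorm v P (volume.restrict (ball 0 (2 ^ n))) ≤ l :=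
      eLpNorm_mono_measure _ (Measure.restrict_mono
        (ball_subset_ball (pow_le_pow_right₀ (by norm_num) (by omega))) le_rfl)
    have l2 : eLpNorm (fun x => rr x ^ (-τ) * EE n (c + 1) v x) P ((muA N).restrict (ball 0 2)) ≤
        C3 * (C1 * l) := by
      refine (eLpNorm_mono_measure _ (Measure.restrict_mono_measure (muA_le N) _)).trans ?_
      refine (eLp_le_mul (g := EE n (c + 1) v) C3 ?_).trans (mul_le_mul' le_rfl ?_)
      · filter_upwards [ae_restrict_mem measurableSet_ball] with x hx
        exact enorm_real_mul_le _ _ (Real.rpow_nonneg (rr_pos x).le _)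
          (rr_pow_le _ 2 (by norm_num) x (by simpa using (mem_ball_zero_iff.1 hx).le)) _
      · have := hC1 v hv 2 (by norm_num)
        rwa [← pow_succ] at this
    calc _ ≤ C * (eLpNorm (fun x => rr x ^ (-τ) * EE n (c + 1) v x) P (muA N) + l) :=
          (hC v hv hf).trans (by gcongr)
      _ ≤ C * (C2 * (w + C3 * (C1 * l)) + l) := by
          gcongr
          exact (hC2 v hv hf).trans (by gcongr)
      _ ≤ C * (C2 * ((w + l) + C3 * (C1 * (w + l))) + (w + l)) := by
          gcongr
          · exact le_self_add
          · exact le_add_self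
          · exact le_add_self
      _ = _ := by push_cast; ring

/-- The global remainder estimate in the invariant measure. -/
lemma glob_rem {N : ℕ} (k : ℕ) (hk : 1 ≤ k) (s : ℝ) (P : ℝ≥0∞) (h1 : 1 ≤ P) (hT : P ≠ ⊤) :
    ∃ C : NNReal, ∀ v : Euc N → ℝ, ContDiff ℝ (⊤ : ℕ∞) v →
      eLpNorm (fun x => rr x ^ (-(s + k)) * EE k 0 v x) P (muA N) ≤
        C * eLpNorm (fun x => rr x ^ (-s) * GG k v x) P (muA N) := by
  obtain ⟨C, hC⟩ := EE_pointwise (N := N) k hk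
  set D : NNReal := Real.toNNReal (((2 : ℝ) ^ k) ^ |s|) with hD
  set ν : Measure ℝ := volume.restrict (Set.Ioc (1 : ℝ) (2 ^ k)) with hν
  have hνf : IsFiniteMeasure ν := ⟨by simp [hν]⟩
  have hνT : ν Set.univ ≠ ⊤ := measure_ne_top _ _
  refine ⟨C * D * (ν Set.univ).toNNReal, fun v hv => ?_⟩
  set H : Euc N → ℝ := fun x => rr x ^ (-s) * GG k v x with hH
  have hGc : Continuous (GG k v) := GG_continuous k v hv
  have hHc : Continuous H := (rr_pow_cont (-s)).mul hGc
  have hK : Measurable (Function.uncurry fun (x : Euc N) (t : ℝ) => ‖H (t • x)‖ₑ) := by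
    apply Continuous.measurable
    exact (hHc.comp (continuous_snd.smul continuous_fst)).enorm
  have key := eLp_avg (muA N) ν P h1 hT (fun (x : Euc N) (t : ℝ) => ‖H (t • x)‖ₑ) hK
    (eLpNorm H P (muA N)) (by
      filter_upwards [ae_restrict_mem measurableSet_Ioc] with t ht
      have := eLp_dil t ht.1.le P H hHc.stronglyMeasurable
      rwa [← eLpNorm_enorm] at this)
  rw [ENNReal.coe_mul, ENNReal.coe_toNNReal hνT, mul_assoc]
  refine le_trans (eLp_le_mul (g := fun x => ∫⁻ t, ‖H (t • x)‖ₑ ∂ν) (C * D) ?_) (by gcongr)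
  filter_upwards [muA_ae N] with x hx
  have h0 := hC v hv 0 x
  simp only [zero_add] at h0
  rw [enorm_eq_self]
  have hr0 := rr_pos x
  have e1 : ‖x‖ₑ ^ k = ‖rr x ^ k‖ₑ := by
    rw [enorm_pow, rr_eq x hx, enorm_norm]
  have e2 : rr x ^ (-(s + k)) * rr x ^ k = rr x ^ (-s) := by
    rw [← Real.rpow_natCast, ← Real.rpow_add hr0]; congr 1; ring
  calc ‖rr x ^ (-(s + k)) * EE k 0 v x‖ₑ
      ≤ ‖rr x ^ (-(s + k))‖ₑ * (C * (‖rr x ^ k‖ₑ * ∫⁻ t, ‖GG k v (t • x)‖ₑ ∂ν)) := by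
        rw [enorm_mul, ← e1]; gcongr
    _ = C * (‖rr x ^ (-s)‖ₑ * ∫⁻ t, ‖GG k v (t • x)‖ₑ ∂ν) := by
        rw [← e2, enorm_mul]; ring
    _ = C * ∫⁻ t, ‖rr x ^ (-s) * GG k v (t • x)‖ₑ ∂ν := by
        rw [← lintegral_const_mul]
        · simp only [enorm_mul]
        · apply Continuous.measurable
          exact (hGc.comp (continuous_id.smul continuous_const)).enorm
    _ ≤ C * ∫⁻ t, D * ‖H (t • x)‖ₑ ∂ν := by
        gcongr C * ?_
        refine lintegral_mono_ae ?_
        filter_upwards [ae_restrict_mem measurableSet_Ioc] with t ht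
        have ht0 : 0 < t := by linarith [ht.1]
        have : rr x ^ (-s) * GG k v (t • x) = t ^ s * H (t • x) := by
          simp only [hH]
          rw [rr_smul x hx t ht.1.le, Real.mul_rpow ht0.le hr0.le, Real.rpow_neg ht0.le]
          have := (Real.rpow_pos_of_pos ht0 s).ne'
          field_simp
        rw [this]
        refine enorm_real_mul_le _ _ (by positivity) ?_ _
        calc t ^ s ≤ t ^ |s| := Real.rpow_le_rpow_of_exponent_le ht.1.le (le_abs_self s)
          _ ≤ _ := Real.rpow_le_rpow ht0.le ht.2 (abs_nonneg s)
    _ = _ := by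
        rw [lintegral_const_mul, ENNReal.coe_mul, mul_assoc]
        apply Continuous.measurable
        exact (hHc.comp (continuous_id.smul continuous_const)).enorm

lemma aff1 {N : ℕ} (x y : Euc N) (t : ℝ) : y + t • (x - y) = y - t • y + t • x := by
  rw [smul_sub]; abel

lemma aff2 {N : ℕ} (x y : Euc N) (t : ℝ) : y + t • (x - y) = t • x + (1 - t) • y := by
  rw [smul_sub, sub_smul, one_smul]; abel

set_option maxHeartbeats 2000000 in
/-- The local estimate. -/
lemma loc_est {N : ℕ} (k : ℕ) (hk : 1 ≤ k) (P : ℝ≥0∞) (h1 : 1 ≤ P) (hT : P ≠ ⊤) (R : ℝ)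
    (hR : 0 < R) :
    ∃ C : NNReal, ∀ v : Euc N → ℝ, ContDiff ℝ (⊤ : ℕ∞) v →
      eLpNorm v P (volume.restrict (ball 0 R)) ≤
        C * (eLpNorm v 1 (volume.restrict (ball 0 (2 ^ k * (R + 1) + 1))) +
          eLpNorm (GG k v) P (volume.restrict (ball 0 (2 ^ k * (R + 1) + 1)))) := by
  obtain ⟨C, hC⟩ := EE_pointwise (N := N) k hk
  obtain ⟨C', hC'⟩ := EE_recover (V := Euc N) k 0
  set R' : ℝ := 2 ^ k * (R + 1) + 1 with hR'
  set ν : Measure ℝ := volume.restrict (Set.Ioc (1 : ℝ) (2 ^ k)) with hν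
  have hνf : IsFiniteMeasure ν := ⟨by simp [hν]⟩
  set β : Measure (Euc N) := volume.restrict (ball 0 1) with hβ
  have hβf : IsFiniteMeasure β := ⟨by simp [hβ, measure_ball_lt_top]⟩
  have hβu : β Set.univ ≠ ⊤ := measure_ne_top _ _
  have hβ0 : β Set.univ ≠ 0 := by
    simp only [hβ, Measure.restrict_apply_univ]
    exact (measure_ball_pos _ _ one_pos).ne'
  set μ : Measure (Euc N) := volume.restrict (ball 0 R) with hμ
  have hμf : IsFiniteMeasure μ := ⟨by simp [hμ, measure_ball_lt_top]⟩
  set ν2 := β.prod ν with hν2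
  set b : ℝ≥0∞ := (β Set.univ)⁻¹ with hb
  have hbT : b ≠ ⊤ := ENNReal.inv_ne_top.2 hβ0
  set X : NNReal := (b * C * ENNReal.ofReal ((R + 1) ^ k)).toNNReal with hX
  have hXe : (X : ℝ≥0∞) = b * C * ENNReal.ofReal ((R + 1) ^ k) := ENNReal.coe_toNNReal
    (ENNReal.mul_ne_top (ENNReal.mul_ne_top hbT ENNReal.coe_ne_top) ENNReal.ofReal_ne_top)
  set Y : NNReal := (b * C' * k).toNNReal with hY
  have hYe : (Y : ℝ≥0∞) = b * C' * k := ENNReal.coe_toNNReal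
    (ENNReal.mul_ne_top (ENNReal.mul_ne_top hbT ENNReal.coe_ne_top) (by simp))
  set Z : ℝ≥0∞ := Y * μ Set.univ ^ (1 / P.toReal) + X * ν2 Set.univ with hZ
  have hZT : Z ≠ ⊤ := by
    refine ENNReal.add_ne_top.2 ⟨ENNReal.mul_ne_top ENNReal.coe_ne_top
      (ENNReal.rpow_ne_top_of_nonneg (by positivity) (measure_ne_top _ _)),
      ENNReal.mul_ne_top ENNReal.coe_ne_top (measure_ne_top _ _)⟩
  refine ⟨Z.toNNReal, fun v hv => ?_⟩
  rw [ENNReal.coe_toNNReal hZT]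
  have hvc : Continuous v := hv.continuous
  have hGc : Continuous (GG k v) := GG_continuous k v hv
  set L := eLpNorm v 1 (volume.restrict (ball 0 R')) with hL
  set G := eLpNorm (GG k v) P (volume.restrict (ball 0 R')) with hG
  set K : Euc N → (Euc N × ℝ) → ℝ≥0∞ := fun x z => ‖GG k v (z.1 + z.2 • (x - z.1))‖ₑ with hKd
  have hKc : Continuous (Function.uncurry K) := by
    simp only [hKd, Function.uncurry_def]
    exact (hGc.comp (by fun_prop)).enorm
  have hbound : ∀ x y : Euc N, ∀ t : ℝ, ‖x‖ < R → ‖y‖ < 1 → 1 ≤ t → t ≤ 2 ^ k →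
      ‖y + t • (x - y)‖ < R' := by
    intro x y t hx hy h1t ht
    have h2 : ‖x - y‖ ≤ R + 1 := (norm_sub_le _ _).trans (by linarith)
    have h3 : ‖t • (x - y)‖ ≤ 2 ^ k * (R + 1) := by
      rw [norm_smul, Real.norm_eq_abs, abs_of_nonneg (by linarith)]
      exact mul_le_mul ht h2 (norm_nonneg _) (by positivity)
    have := norm_add_le y (t • (x - y))
    rw [hR']; linarith
  have key : eLpNorm (fun x => ∫⁻ z, K x z ∂ν2) P μ ≤ ν2 Set.univ * G := by
    refine eLp_avg μ ν2 P h1 hT K hKc.measurable G ?_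
    have hmem : ∀ᵐ z ∂ν2, z ∈ ball (0 : Euc N) 1 ×ˢ Set.Ioc (1 : ℝ) (2 ^ k) := by
      rw [hν2, hβ, hν, Measure.prod_restrict]
      exact ae_restrict_mem (measurableSet_ball.prod measurableSet_Ioc)
    filter_upwards [hmem] with z hz
    obtain ⟨hz1, hz2⟩ := hz
    have := eLp_affine_restrict (z.1 - z.2 • z.1) z.2
      (by rw [abs_of_nonneg (by linarith [hz2.1])]; exact hz2.1.le) P (GG k v)
      hGc.stronglyMeasurable (ball 0 R) (ball 0 R') measurableSet_ball (fun x hx => by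
        have := hbound x z.1 z.2 (by simpa using hx) (by simpa using hz1) hz2.1.le hz2.2
        rw [mem_ball_zero_iff, ← aff1]
        exact this)
    rw [← eLpNorm_enorm] at this
    simp only [← aff1] at this
    exact this
  have pt : ∀ x ∈ ball (0 : Euc N) R, ‖v x‖ₑ ≤ X * (∫⁻ z, K x z ∂ν2) + Y * L := by
    intro x hx
    have hx' : ‖x‖ < R := by simpa using hx
    have e0 : ‖v x‖ₑ = b * ∫⁻ y, ‖v x‖ₑ ∂β := by
      rw [lintegral_const, mul_comm, mul_assoc, hb, ENNReal.mul_inv_cancel hβ0 hβu, mul_one]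
    have hKx : Measurable (K x) := by
      apply Continuous.measurable
      simp only [hKd]
      exact (hGc.comp (by fun_prop)).enorm
    have vm : ∀ i : ℕ, Measurable fun y => ‖v (y + (2 : ℝ) ^ (i + 1) • (x - y))‖ₑ := fun i => by
      apply Continuous.measurable
      exact (hvc.comp (by fun_prop)).enorm
    have e1 : ∫⁻ y, ‖v x‖ₑ ∂β ≤ ∫⁻ y, (C * (ENNReal.ofReal ((R + 1) ^ k) * ∫⁻ t, K x (y, t) ∂ν)
        + C' * ∑ i ∈ Finset.range k, ‖v (y + (2 : ℝ) ^ (i + 1) • (x - y))‖ₑ) ∂β := by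
      refine lintegral_mono_ae ?_
      filter_upwards [ae_restrict_mem measurableSet_ball] with y hy
      have hy' : ‖y‖ < 1 := by simpa using hy
      have a1 := hC v hv y (x - y)
      have a2 := hC' (fun z => v (y + z)) (x - y)
      simp only [add_sub_cancel] at a2
      set E := EE k 0 (fun z => v (y + z)) (x - y)
      have a3 : ‖v x - E‖ₑ ≤ C' * ∑ i ∈ Finset.range k, ‖v (y + (2 : ℝ) ^ (i + 1) • (x - y))‖ₑ := by
        have : ‖v x - E‖ₑ ≤ ENNReal.ofReal
            (C' * ∑ i ∈ Finset.range k, |v (y + (2 : ℝ) ^ (i + 1) • (x - y))|) := by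
          rw [Real.enorm_eq_ofReal_abs]
          exact ENNReal.ofReal_le_ofReal a2
        rw [ENNReal.ofReal_mul C'.coe_nonneg, ENNReal.ofReal_sum_of_nonneg
          (fun i _ => abs_nonneg _), ENNReal.ofReal_coe_nnreal] at this
        simpa only [Real.enorm_eq_ofReal_abs] using this
      have a4 : ‖v x‖ₑ ≤ ‖E‖ₑ + ‖v x - E‖ₑ := by
        have := enorm_add_le E (v x - E)
        rwa [add_sub_cancel] at this
      refine a4.trans (add_le_add (a1.trans ?_) a3)
      gcongr
      have h2 : ‖x - y‖ ≤ R + 1 := (norm_sub_le _ _).trans (by linarith)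
      rw [← enorm_norm, ← enorm_pow, Real.enorm_of_nonneg (by positivity)]
      exact ENNReal.ofReal_le_ofReal (by gcongr)
    have e2 : ∫⁻ z, K x z ∂ν2 = ∫⁻ y, ∫⁻ t, K x (y, t) ∂ν ∂β := by
      rw [hν2, lintegral_prod]
      exact hKx.aemeasurable
    have mI : Measurable fun y => ∫⁻ t, K x (y, t) ∂ν := by
      refine Measurable.lintegral_prod_right' (f := fun z : Euc N × ℝ => K x z) ?_
      exact hKx
    have e3 : ∀ i ∈ Finset.range k, ∫⁻ y, ‖v (y + (2 : ℝ) ^ (i + 1) • (x - y))‖ₑ ∂β ≤ L := by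
      intro i hi
      have h2 : (2 : ℝ) ≤ 2 ^ (i + 1) := by
        rw [pow_succ]; have : (1 : ℝ) ≤ 2 ^ i := one_le_pow₀ (by norm_num)
        linarith
      have h3 : (2 : ℝ) ^ (i + 1) ≤ 2 ^ k :=
        pow_le_pow_right₀ (by norm_num) (by have := Finset.mem_range.1 hi; omega)
      have := eLp_affine_restrict ((2 : ℝ) ^ (i + 1) • x) (1 - 2 ^ (i + 1))
        (by rw [abs_of_nonpos (by linarith)]; linarith) 1 v
        hvc.stronglyMeasurable (ball 0 1) (ball 0 R') measurableSet_ball (fun y hy => by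
          have := hbound x y (2 ^ (i + 1)) hx' (by simpa using hy) (by linarith) h3
          rw [mem_ball_zero_iff, ← aff2]
          exact this)
      rw [eLpNorm_one_eq_lintegral_enorm] at this
      simp only [← aff2] at this
      exact this
    calc ‖v x‖ₑ = b * ∫⁻ y, ‖v x‖ₑ ∂β := e0
      _ ≤ _ := mul_le_mul_right e1 b
      _ = b * (C * (ENNReal.ofReal ((R + 1) ^ k) * ∫⁻ z, K x z ∂ν2) +
          C' * ∑ i ∈ Finset.range k, ∫⁻ y, ‖v (y + (2 : ℝ) ^ (i + 1) • (x - y))‖ₑ ∂β) := by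
        rw [lintegral_add_left (by fun_prop), lintegral_const_mul _ (by fun_prop),
          lintegral_const_mul _ mI, lintegral_const_mul _ (by fun_prop),
          lintegral_finsetSum _ (fun i _ => vm i), e2]
      _ ≤ b * (C * (ENNReal.ofReal ((R + 1) ^ k) * ∫⁻ z, K x z ∂ν2) +
          C' * ∑ i ∈ Finset.range k, L) := by
        gcongr with i hi; exact e3 i hi
      _ = _ := by
        rw [hXe, hYe, Finset.sum_const, Finset.card_range, nsmul_eq_mul]; ring
  have mK : Measurable fun x => ∫⁻ z, K x z ∂ν2 :=
    Measurable.lintegral_prod_right' (f := Function.uncurry K) hKc.measurable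
  calc eLpNorm v P μ ≤ eLpNorm ((fun x => X * ∫⁻ z, K x z ∂ν2) + fun _ => Y * L) P μ := by
        refine eLpNorm_mono_enorm_ae ?_
        filter_upwards [ae_restrict_mem measurableSet_ball] with x hx
        simpa using pt x hx
    _ ≤ eLpNorm (fun x => X * ∫⁻ z, K x z ∂ν2) P μ + eLpNorm (fun _ : Euc N => Y * L) P μ :=
        eLpNorm_add_le (mK.const_mul _).stronglyMeasurable.aestronglyMeasurable
          aestronglyMeasurable_const h1
    _ ≤ X * (ν2 Set.univ * G) + Y * L * μ Set.univ ^ (1 / P.toReal) := by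
        refine add_le_add ((eLp_le_mul (g := fun x => ∫⁻ z, K x z ∂ν2) X ?_).trans
          (by gcongr)) ?_
        · exact Eventually.of_forall fun x => le_rfl
        · rw [eLpNorm_const' _ (zero_lt_one.trans_le h1).ne' hT, enorm_eq_self]
    _ ≤ _ := by
        rw [hZ, mul_add, add_mul, add_mul]
        have : X * (ν2 Set.univ * G) = X * ν2 Set.univ * G := by ring
        rw [this]
        have : Y * L * μ Set.univ ^ (1 / P.toReal) = Y * μ Set.univ ^ (1 / P.toReal) * L := by ring
        rw [this]
        generalize (Y : ℝ≥0∞) * μ Set.univ ^ (1 / P.toReal) * L = a1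
        generalize (Y : ℝ≥0∞) * μ Set.univ ^ (1 / P.toReal) * G = a2
        generalize (X : ℝ≥0∞) * ν2 Set.univ * G = a3
        generalize (X : ℝ≥0∞) * ν2 Set.univ * L = a4
        calc a3 + a1 = a1 + a3 + 0 := by ring
          _ ≤ a1 + a3 + (a4 + a2) := by gcongr; simp
          _ = _ := by ring

/-- The smooth weight `(1+|x|)^a`. -/
def ww {N : ℕ} (a : ℝ) (x : Euc N) : ℝ := (1 + ‖x‖) ^ a

lemma one_add_pos {N : ℕ} (x : Euc N) : 0 < 1 + ‖x‖ := by positivity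

lemma ww_pos {N : ℕ} (a : ℝ) (x : Euc N) : 0 < ww a x := Real.rpow_pos_of_pos (one_add_pos x) a

lemma ww_cont {N : ℕ} (a : ℝ) : Continuous (fun x : Euc N => ww a x) :=
  (continuous_const.add continuous_norm).rpow_const fun x => Or.inl (one_add_pos x).ne'

lemma pow_comp (x y c a : ℝ) (hx : 0 < x) (hy : 0 < y) (hc : 1 ≤ c) (h1 : x ≤ c * y)
    (h2 : y ≤ c * x) : x ^ a ≤ c ^ |a| * y ^ a := by
  have hc0 : 0 < c := by linarith
  rcases le_total 0 a with ha | ha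
  · rw [abs_of_nonneg ha, ← Real.mul_rpow hc0.le hy.le]
    exact Real.rpow_le_rpow hx.le h1 ha
  · rw [abs_of_nonpos ha, Real.rpow_neg hc0.le, ← Real.inv_rpow hc0.le,
      ← Real.mul_rpow (by positivity) hy.le]
    refine Real.rpow_le_rpow_of_nonpos (by positivity) ?_ ha
    rw [inv_mul_le_iff₀ hc0]; exact h2

lemma ww_rr {N : ℕ} (a : ℝ) (x : Euc N) : ww a x ≤ 2 ^ |a| * rr x ^ a := by
  have h := norm_nonneg x
  refine pow_comp _ _ 2 a (one_add_pos x) (rr_pos x) (by norm_num) ?_ ?_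
  · have := rr_one_le x
    have : ‖x‖ ≤ rr x := le_max_right _ _
    linarith
  · exact max_le (by linarith) (by linarith)

lemma rr_ww {N : ℕ} (a : ℝ) (x : Euc N) : rr x ^ a ≤ 2 ^ |a| * ww a x := by
  have h := norm_nonneg x
  refine pow_comp _ _ 2 a (rr_pos x) (one_add_pos x) (by norm_num) ?_ ?_
  · exact max_le (by linarith) (by linarith)
  · have := rr_one_le x
    have : ‖x‖ ≤ rr x := le_max_right _ _
    linarith

lemma enorm_wt_le (a b C f : ℝ) (ha : 0 ≤ a) (hb : 0 ≤ b) (hC : 0 ≤ C) (h : a ≤ C * b) :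
    ‖a * f‖ₑ ≤ (Real.toNNReal C : NNReal) * ‖b * f‖ₑ := by
  have : (Real.toNNReal C : NNReal) * ‖b * f‖ₑ = ‖C * (b * f)‖ₑ := by
    rw [enorm_mul C, Real.enorm_of_nonneg hC]; rfl
  rw [this, ← mul_assoc, enorm_mul, enorm_mul, Real.enorm_of_nonneg ha,
    Real.enorm_of_nonneg (mul_nonneg hC hb)]
  gcongr

lemma eLp_ww_rr {N : ℕ} (a : ℝ) (P : ℝ≥0∞) (μ : Measure (Euc N)) (f : Euc N → ℝ) :
    eLpNorm (fun x => ww a x * f x) P μ ≤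
      (Real.toNNReal (2 ^ |a|) : NNReal) * eLpNorm (fun x => rr x ^ a * f x) P μ :=
  eLp_le_mul _ (Eventually.of_forall fun x => enorm_wt_le _ _ _ _ (ww_pos a x).le
    (Real.rpow_pos_of_pos (rr_pos x) a).le (by positivity) (ww_rr a x))

lemma eLp_rr_ww {N : ℕ} (a : ℝ) (P : ℝ≥0∞) (μ : Measure (Euc N)) (f : Euc N → ℝ) :
    eLpNorm (fun x => rr x ^ a * f x) P μ ≤
      (Real.toNNReal (2 ^ |a|) : NNReal) * eLpNorm (fun x => ww a x * f x) P μ :=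
  eLp_le_mul _ (Eventually.of_forall fun x => enorm_wt_le _ _ _ _
    (Real.rpow_pos_of_pos (rr_pos x) a).le (ww_pos a x).le (by positivity) (rr_ww a x))

lemma eLp_ball_rr {N : ℕ} (a R : ℝ) (hR : 1 ≤ R) (P : ℝ≥0∞) (f : Euc N → ℝ) :
    eLpNorm f P (volume.restrict (ball 0 R)) ≤
      (Real.toNNReal (R ^ |a|) : NNReal) * eLpNorm (fun x => rr x ^ a * f x) P volume := by
  refine (eLp_le_mul (g := fun x => rr x ^ a * f x) (Real.toNNReal (R ^ |a|)) ?_).trans ?_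
  · filter_upwards [ae_restrict_mem measurableSet_ball] with x hx
    have := enorm_wt_le 1 (rr x ^ a) (R ^ |a|) (f x) (by norm_num)
      (Real.rpow_pos_of_pos (rr_pos x) a).le (by positivity) (by
        have := rr_pow_le (-a) R hR x (by have : ‖x‖ < R := by simpa using hx
                                          exact this.le)
        rw [abs_neg] at this
        calc (1 : ℝ) = rr x ^ (-a) * rr x ^ a := by rw [← Real.rpow_add (rr_pos x)]; simp
          _ ≤ _ := by
            have h0 := (Real.rpow_pos_of_pos (rr_pos x) a).le
            gcongr)
    rwa [one_mul] at this
  · gcongr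
    exact Measure.restrict_le_self

lemma eLp_GG {N : ℕ} (k : ℕ) (a : ℝ) (P : ℝ≥0∞) (h1 : 1 ≤ P) (μ : Measure (Euc N))
    (v : Euc N → ℝ) (hv : ContDiff ℝ (⊤ : ℕ∞) v) :
    eLpNorm (fun x => rr x ^ a * GG k v x) P μ ≤
      ∑ m : Fin k → Fin N, eLpNorm (fun x => rr x ^ a * pderivList (List.ofFn m) v x) P μ := by
  have e : (fun x => rr x ^ a * GG k v x) =
      ∑ m : Fin k → Fin N, fun x => ‖rr x ^ a * pderivList (List.ofFn m) v x‖ := by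
    ext x
    rw [Finset.sum_apply]
    simp only [GG, Finset.mul_sum, norm_mul, Real.norm_eq_abs,
      abs_of_pos (Real.rpow_pos_of_pos (rr_pos x) a)]
  rw [e]
  refine (eLpNorm_sum_le (fun m _ => ?_) h1).trans ?_
  · apply Continuous.aestronglyMeasurable
    exact ((rr_pow_cont a).mul (contDiff_pderivList _ v hv).continuous).norm
  · refine Finset.sum_le_sum fun m _ => ?_
    rw [eLpNorm_norm]

lemma choose_delta (k : ℕ) (s : ℝ) : ∃ δ : ℝ, 0 < δ ∧ ∀ j : ℕ, j < k →
    (s + k - j < 0 → s + k - j + δ < 0) := by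
  have h : ∀ᶠ δ in 𝓝[>] (0 : ℝ), ∀ j ∈ Finset.range k, (s + k - j < 0 → s + k - j + δ < 0) := by
    rw [Filter.eventually_all_finset]
    intro j _
    by_cases hj : s + k - j < 0
    · have : ∀ᶠ δ in 𝓝 (0 : ℝ), s + k - j + δ < 0 :=
        (continuous_const.add continuous_id).continuousAt.eventually_lt continuousAt_const
          (by simpa using hj)
      exact (this.filter_mono nhdsWithin_le_nhds).mono fun δ h _ => h
    · exact Eventually.of_forall fun δ h => absurd h hj
  obtain ⟨δ, h1, h2⟩ := (h.and self_mem_nhdsWithin).exists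
  exact ⟨δ, h2, fun j hj => h1 j (Finset.mem_range.2 hj)⟩

lemma smooth_main {N : ℕ} (k : ℕ) (hk : 1 ≤ k) (s : ℝ)
    (hs : ∀ m : ℕ, 1 ≤ m → m ≤ k → s ≠ -(m : ℝ)) (P : ℝ≥0∞) (h1 : 1 ≤ P) (hT : P ≠ ⊤) :
    ∃ δ : ℝ, 0 < δ ∧ ∃ C : NNReal, ∀ v : Euc N → ℝ, ContDiff ℝ (⊤ : ℕ∞) v →
      eLpNorm (fun x => ww (-(s + k) - δ - N) x * v x) 1 volume ≠ ⊤ →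
      eLpNorm (fun x => ww (-(s + k) - N / P.toReal) x * v x) P volume ≤
        C * (eLpNorm (fun x => ww (-(s + k) - δ - N) x * v x) 1 volume +
          ∑ m : Fin k → Fin N,
            eLpNorm (fun x => ww (-s - N / P.toReal) x * pderivList (List.ofFn m) v x) P volume) := by
  obtain ⟨δ, hδ, hδ2⟩ := choose_delta k s
  obtain ⟨C1, hC1⟩ := hardy_chain (N := N) P h1 (s + k) δ k 0 (by
    intro j hj
    simp only [zero_add]
    refine ⟨?_, hδ2 j hj⟩
    have := hs (k - j) (by omega) (by omega)
    rw [Nat.cast_sub hj.le] at this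
    intro h
    exact this (by linarith))
  obtain ⟨C2, hC2⟩ := glob_rem (N := N) k hk s P h1 hT
  obtain ⟨C3, hC3⟩ := loc_est (N := N) k hk P h1 hT (2 ^ k) (by positivity)
  set R' : ℝ := 2 ^ k * (2 ^ k + 1) + 1 with hR'
  have hR1 : 1 ≤ R' := by
    have : (0 : ℝ) ≤ 2 ^ k * (2 ^ k + 1) := by positivity
    rw [hR']; linarith
  set w := -(s + k) - N / P.toReal with hw
  set w1 := -(s + k) - δ - N with hw1
  set wg := -s - N / P.toReal with hwg
  set a0 : NNReal := Real.toNNReal (2 ^ |w|) with ha0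
  set a1 : NNReal := Real.toNNReal (2 ^ |w1|) with ha1
  set a2 : NNReal := Real.toNNReal (2 ^ |wg|) with ha2
  set b1 : NNReal := Real.toNNReal (R' ^ |w1|) with hb1
  set b2 : NNReal := Real.toNNReal (R' ^ |wg|) with hb2
  set b0 : NNReal := Real.toNNReal (1 ^ |w|) with hb0
  set e0 : NNReal := Real.toNNReal ((1 : ℝ) ^ |w|) with he0
  refine ⟨δ, hδ, a0 * (C1 * (C2 * a2) + (C1 + e0) * (C3 * (b1 * a1 + b2 * a2))), ?_⟩
  intro v hv hfin
  have hvc := hv.continuous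
  set I1 := eLpNorm (fun x => ww w1 x * v x) 1 volume with hI1
  set S := ∑ m : Fin k → Fin N,
    eLpNorm (fun x => ww wg x * pderivList (List.ofFn m) v x) P volume with hS
  have hrr1 : eLpNorm (fun x => rr x ^ w1 * v x) 1 volume ≤ a1 * I1 := eLp_rr_ww w1 1 volume v
  have hGG : eLpNorm (fun x => rr x ^ wg * GG k v x) P volume ≤ a2 * S := by
    refine (eLp_GG k wg P h1 volume v hv).trans ?_
    rw [hS, Finset.mul_sum]
    exact Finset.sum_le_sum fun m _ => eLp_rr_ww wg P volume _
  have hloc : eLpNorm v P (volume.restrict (ball 0 (2 ^ k))) ≤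
      (C3 * (b1 * a1 + b2 * a2) : NNReal) * (I1 + S) := by
    refine (hC3 v hv).trans ?_
    have t1 : eLpNorm v 1 (volume.restrict (ball 0 R')) ≤ b1 * (a1 * I1) :=
      (eLp_ball_rr w1 R' hR1 1 v).trans (by gcongr)
    have t2 : eLpNorm (GG k v) P (volume.restrict (ball 0 R')) ≤ b2 * (a2 * S) :=
      (eLp_ball_rr wg R' hR1 P (GG k v)).trans (by gcongr)
    push_cast
    calc C3 * (eLpNorm v 1 (volume.restrict (ball 0 R')) +
          eLpNorm (GG k v) P (volume.restrict (ball 0 R')))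
        ≤ C3 * (b1 * (a1 * I1) + b2 * (a2 * S)) := by gcongr
      _ ≤ C3 * (b1 * (a1 * (I1 + S)) + b2 * (a2 * (I1 + S))) := by
          gcongr
          · exact le_self_add
          · exact le_add_self
      _ = _ := by ring
  have hrem : eLpNorm (fun x => rr x ^ (-(s + k)) * EE k 0 v x) P (muA N) ≤
      (C2 * a2 : NNReal) * (I1 + S) := by
    refine (hC2 v hv).trans ?_
    rw [eLp_muA P h1 hT]
    push_cast
    rw [mul_assoc]
    gcongr
    calc _ ≤ eLpNorm (fun x => rr x ^ wg * GG k v x) P volume := by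
          gcongr
          exact Measure.restrict_le_self
      _ ≤ a2 * S := hGG
      _ ≤ _ := by gcongr; exact le_add_self
  have hfin' : eLpNorm (fun x => rr x ^ (-(s + k) - δ) * v x) 1 (muA N) ≠ ⊤ := by
    rw [eLp_muA 1 le_rfl (by simp)]
    simp only [ENNReal.toReal_one, div_one]
    have : eLpNorm (fun x => rr x ^ w1 * v x) 1 volume ≠ ⊤ :=
      (hrr1.trans_lt (ENNReal.mul_lt_top ENNReal.coe_lt_top hfin.lt_top)).ne
    exact ((eLpNorm_mono_measure _ Measure.restrict_le_self).trans_lt this.lt_top).ne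
  have hA := hC1 v hvc hfin'
  rw [eLp_muA P h1 hT] at hA
  have hB : eLpNorm (fun x => rr x ^ w * v x) P (volume.restrict {x : Euc N | 1 ≤ ‖x‖}ᶜ) ≤
      e0 * eLpNorm v P (volume.restrict (ball 0 (2 ^ k))) := by
    have hss : {x : Euc N | 1 ≤ ‖x‖}ᶜ ⊆ ball 0 (2 ^ k) := by
      intro x hx
      simp only [Set.mem_compl_iff, Set.mem_setOf_eq, not_le] at hx
      rw [mem_ball_zero_iff]
      exact hx.trans_le (one_le_pow₀ (by norm_num))
    refine (eLp_le_mul (g := v) e0 ?_).trans (by gcongr)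
    filter_upwards [ae_restrict_mem (measA N 1).compl] with x hx
    simp only [Set.mem_compl_iff, Set.mem_setOf_eq, not_le] at hx
    exact enorm_real_mul_le _ _ (Real.rpow_pos_of_pos (rr_pos x) w).le
      (rr_pow_le w 1 le_rfl x hx.le) _
  calc eLpNorm (fun x => ww w x * v x) P volume
      ≤ a0 * eLpNorm (fun x => rr x ^ w * v x) P volume := eLp_ww_rr w P volume v
    _ ≤ a0 * (eLpNorm (fun x => rr x ^ w * v x) P (volume.restrict {x : Euc N | 1 ≤ ‖x‖}) +
          eLpNorm (fun x => rr x ^ w * v x) P (volume.restrict {x : Euc N | 1 ≤ ‖x‖}ᶜ)) := by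
        gcongr
        exact eLp_split volume P h1 _ ((rr_pow_cont w).mul hvc).measurable _ (measA N 1)
    _ ≤ a0 * (C1 * ((C2 * a2 : NNReal) * (I1 + S) +
          (C3 * (b1 * a1 + b2 * a2) : NNReal) * (I1 + S)) +
          e0 * ((C3 * (b1 * a1 + b2 * a2) : NNReal) * (I1 + S))) := by
        gcongr
        · exact hA.trans (by gcongr)
        · exact hB.trans (by gcongr)
    _ = _ := by push_cast; ring

/-- Convolution against a kernel. -/
def moll {N : ℕ} (ρ u : Euc N → ℝ) : Euc N → ℝ :=
  convolution u ρ (ContinuousLinearMap.mul ℝ ℝ) volume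

lemma moll_apply {N : ℕ} (ρ u : Euc N → ℝ) (x : Euc N) : moll ρ u x = ∫ t, u t * ρ (x - t) :=
  convolution_mul

lemma moll_apply' {N : ℕ} (ρ u : Euc N → ℝ) (x : Euc N) : moll ρ u x = ∫ t, ρ t * u (x - t) := by
  rw [moll_apply, ← integral_sub_left_eq_self _ volume x]
  refine integral_congr_ae (Eventually.of_forall fun t => ?_)
  simp [mul_comm]

lemma moll_contDiff {N : ℕ} (ρ u : Euc N → ℝ) (hρ : ContDiff ℝ (⊤ : ℕ∞) ρ)
    (hc : HasCompactSupport ρ) (hu : LocallyIntegrable u volume) :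
    ContDiff ℝ (⊤ : ℕ∞) (moll ρ u) :=
  hc.contDiff_convolution_right _ hu hρ

lemma pderivList_moll {N : ℕ} (l : List (Fin N)) (ρ u : Euc N → ℝ) (hρ : ContDiff ℝ (⊤ : ℕ∞) ρ)
    (hc : HasCompactSupport ρ) (hu : LocallyIntegrable u volume) :
    pderivList l (moll ρ u) = moll (pderivList l ρ) u := by
  induction l generalizing ρ with
  | nil => rfl
  | cons i l ih =>
    rw [pderivList, pderivList, ← ih _ (contDiff_pd i ρ hρ) (hc.fderiv_apply ℝ _)]
    congr 1
    ext x
    rw [moll, (hc.hasFDerivAt_convolution_right (ContinuousLinearMap.mul ℝ ℝ) hu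
      (hρ.of_le (by exact_mod_cast le_top)) x).fderiv, convolution_precompR_apply _ hu
      (hc.fderiv ℝ) (hρ.continuous_fderiv (by simp)), moll]

lemma pderivList_reflect {N : ℕ} (l : List (Fin N)) (ρ : Euc N → ℝ) (hρ : ContDiff ℝ (⊤ : ℕ∞) ρ)
    (c : ℝ) (x : Euc N) :
    pderivList l (fun t => c * ρ (x - t)) =
      fun t => c * (-1) ^ l.length * pderivList l ρ (x - t) := by
  induction l generalizing ρ c with
  | nil => simp [pderivList]
  | cons i l ih =>
    rw [pderivList, pderivList]
    have e : (fun t => fderiv ℝ (fun t => c * ρ (x - t)) t (EuclideanSpace.single i 1)) =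
        fun t => (-c) * (fun y => fderiv ℝ ρ y (EuclideanSpace.single i 1)) (x - t) := by
      ext t
      have hd : HasFDerivAt ρ (fderiv ℝ ρ (x - t)) (x - t) :=
        (hρ.differentiable (by simp) _).hasFDerivAt
      have h2 : HasFDerivAt (fun t : Euc N => x - t) (-(ContinuousLinearMap.id ℝ (Euc N))) t :=
        (hasFDerivAt_id t).const_sub x
      have h3 := (hd.comp t h2).const_mul c
      have h4 : fderiv ℝ (fun t => c * ρ (x - t)) t = _ := h3.fderiv
      rw [h4]
      simp
    rw [e, ih _ (contDiff_pd i ρ hρ)]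
    ext t
    rw [List.length_cons, pow_succ]; ring

lemma pderivList_moll_weak {N : ℕ} (l : List (Fin N)) (ρ u g : Euc N → ℝ)
    (hρ : ContDiff ℝ (⊤ : ℕ∞) ρ) (hc : HasCompactSupport ρ) (h : IsWeakDerivList l u g) :
    pderivList l (moll ρ u) = moll ρ g := by
  rw [pderivList_moll l ρ u hρ hc h.1]
  ext x
  have h3 := h.2.2 (fun t => 1 * ρ (x - t)) (contDiff_const.mul (hρ.comp (contDiff_const.sub contDiff_id)))
    (by
      have : HasCompactSupport (ρ ∘ (Homeomorph.subLeft x)) := hc.comp_homeomorph _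
      simp only [one_mul]
      exact this)
  rw [pderivList_reflect l ρ hρ] at h3
  simp only [one_mul] at h3
  rw [moll_apply, moll_apply]
  have h4 : ∫ t, u t * ((-1) ^ l.length * pderivList l ρ (x - t)) =
      (-1) ^ l.length * ∫ t, u t * pderivList l ρ (x - t) := by
    rw [← integral_const_mul]
    congr 1; ext t; ring
  rw [h4] at h3
  exact mul_left_cancel₀ (pow_ne_zero _ (by norm_num)) h3

lemma ww_shift {N : ℕ} (a : ℝ) (x t : Euc N) (ht : ‖t‖ ≤ 1) : ww a x ≤ 2 ^ |a| * ww a (x - t) := by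
  have h := norm_nonneg x
  have h' := norm_nonneg (x - t)
  refine pow_comp _ _ 2 a (one_add_pos x) (one_add_pos _) (by norm_num) ?_ ?_
  · have := norm_add_le (x - t) t
    rw [sub_add_cancel] at this
    linarith
  · have := norm_sub_le x t
    linarith

lemma moll_bound_meas {N : ℕ} (a : ℝ) (P : ℝ≥0∞) (h1 : 1 ≤ P) (hT : P ≠ ⊤) (ρ u : Euc N → ℝ)
    (hρ : Continuous ρ) (hρi : Integrable ρ volume) (h0 : ∀ x, 0 ≤ ρ x) (hρ1 : ∫ x, ρ x = 1)
    (hsupp : ∀ x, ρ x ≠ 0 → ‖x‖ ≤ 1) (hu : Measurable u) :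
    eLpNorm (fun x => ww a x * moll ρ u x) P volume ≤
      (Real.toNNReal (2 ^ |a|) : NNReal) * eLpNorm (fun x => ww a x * u x) P volume := by
  set H : Euc N → ℝ := fun x => ww a x * u x with hH
  have hHm : Measurable H := (ww_cont a).measurable.mul hu
  have hρm : Measurable fun t => ENNReal.ofReal (ρ t) := hρ.measurable.ennreal_ofReal
  set ν : Measure (Euc N) := volume.withDensity fun t => ENNReal.ofReal (ρ t) with hν
  have hνu : ν Set.univ = 1 := by
    rw [hν, withDensity_apply _ MeasurableSet.univ, Measure.restrict_univ,
      ← ofReal_integral_eq_lintegral_ofReal hρi (Eventually.of_forall h0), hρ1, ENNReal.ofReal_one]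
  have hνf : IsFiniteMeasure ν := ⟨by rw [hνu]; exact ENNReal.one_lt_top⟩
  have key := eLp_avg volume ν P h1 hT (fun (x t : Euc N) => ‖H (x - t)‖ₑ)
    (hHm.comp (measurable_fst.sub measurable_snd)).enorm (eLpNorm H P volume) (by
      refine Eventually.of_forall fun t => ?_
      have := eLp_affine (-t) 1 (by simp) P H hHm.stronglyMeasurable
      rw [← eLpNorm_enorm] at this
      simpa only [one_smul, neg_add_eq_sub] using this)
  rw [hνu, one_mul] at key
  refine le_trans (eLp_le_mul (g := fun x => ∫⁻ t, ‖H (x - t)‖ₑ ∂ν) (Real.toNNReal (2 ^ |a|)) ?_)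
    (by gcongr)
  refine Eventually.of_forall fun x => ?_
  have hmx : Measurable fun t => ‖H (x - t)‖ₑ := (hHm.comp (measurable_const.sub measurable_id)).enorm
  rw [enorm_eq_self, hν, lintegral_withDensity_eq_lintegral_mul _ hρm hmx, moll_apply',
    ← integral_const_mul]
  refine (enorm_integral_le_lintegral_enorm _).trans ?_
  rw [← lintegral_const_mul _ (hρm.mul hmx)]
  refine lintegral_mono fun t => ?_
  by_cases ht : ρ t = 0
  · simp [ht]
  · have e : ww a x * (ρ t * u (x - t)) = ρ t * (ww a x * u (x - t)) := by ring
    simp only [Pi.mul_apply]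
    rw [e, enorm_mul, Real.enorm_of_nonneg (h0 t), mul_left_comm]
    gcongr
    exact enorm_wt_le _ _ _ _ (ww_pos a x).le (ww_pos a _).le (by positivity)
      (ww_shift a x t (hsupp t ht))

lemma moll_bound {N : ℕ} (a : ℝ) (P : ℝ≥0∞) (h1 : 1 ≤ P) (hT : P ≠ ⊤) (ρ u : Euc N → ℝ)
    (hρ : Continuous ρ) (hρi : Integrable ρ volume) (h0 : ∀ x, 0 ≤ ρ x) (hρ1 : ∫ x, ρ x = 1)
    (hsupp : ∀ x, ρ x ≠ 0 → ‖x‖ ≤ 1) (hu : LocallyIntegrable u volume) :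
    eLpNorm (fun x => ww a x * moll ρ u x) P volume ≤
      (Real.toNNReal (2 ^ |a|) : NNReal) * eLpNorm (fun x => ww a x * u x) P volume := by
  have hm := hu.aestronglyMeasurable
  have e1 : moll ρ u = moll ρ (hm.mk u) := by
    ext x
    rw [moll_apply, moll_apply]
    refine integral_congr_ae ?_
    filter_upwards [hm.ae_eq_mk] with t ht
    rw [ht]
  have e2 : eLpNorm (fun x => ww a x * u x) P volume =
      eLpNorm (fun x => ww a x * hm.mk u x) P volume := by
    refine eLpNorm_congr_ae ?_
    filter_upwards [hm.ae_eq_mk] with t ht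
    rw [ht]
  rw [e1, e2]
  exact moll_bound_meas a P h1 hT ρ _ hρ hρi h0 hρ1 hsupp hm.stronglyMeasurable_mk.measurable

/-- A sequence of bumps shrinking to the origin. -/
def bumpSeq (N : ℕ) (n : ℕ) : ContDiffBump (0 : Euc N) :=
  ⟨1 / (2 * ((n : ℝ) + 1)), 1 / ((n : ℝ) + 1), by positivity, by
    have : (0 : ℝ) < n + 1 := by positivity
    gcongr; linarith⟩

/-- The weighted estimate for weakly differentiable functions, with an `L¹` control. -/
lemma weak_main {N : ℕ} (k : ℕ) (hk : 1 ≤ k) (s : ℝ)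
    (hs : ∀ m : ℕ, 1 ≤ m → m ≤ k → s ≠ -(m : ℝ)) (P : ℝ≥0∞) (h1 : 1 ≤ P) (hT : P ≠ ⊤) :
    ∃ δ : ℝ, 0 < δ ∧ ∃ C : NNReal, ∀ (u : Euc N → ℝ) (g : (Fin k → Fin N) → Euc N → ℝ),
      LocallyIntegrable u volume → (∀ m, IsWeakDerivList (List.ofFn m) u (g m)) →
      eLpNorm (fun x => ww (-(s + k) - δ - N) x * u x) 1 volume ≠ ⊤ →
      eLpNorm (fun x => ww (-(s + k) - N / P.toReal) x * u x) P volume ≤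
        C * (eLpNorm (fun x => ww (-(s + k) - δ - N) x * u x) 1 volume +
          ∑ m : Fin k → Fin N,
            eLpNorm (fun x => ww (-s - N / P.toReal) x * g m x) P volume) := by
  obtain ⟨δ, hδ, C, hC⟩ := smooth_main (N := N) k hk s hs P h1 hT
  set w := -(s + k) - N / P.toReal with hw
  set w1 := -(s + k) - δ - N with hw1
  set wg := -s - N / P.toReal with hwg
  set a1 : NNReal := Real.toNNReal (2 ^ |w1|) with ha1
  set a2 : NNReal := Real.toNNReal (2 ^ |wg|) with ha2
  refine ⟨δ, hδ, C * (a1 + a2), fun u g hu hg hfin => ?_⟩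
  set ρ : ℕ → Euc N → ℝ := fun n => (bumpSeq N n).normed volume with hρd
  have hρs : ∀ n, ContDiff ℝ (⊤ : ℕ∞) (ρ n) := fun n => ContDiffBump.contDiff_normed _
  have hρc : ∀ n, HasCompactSupport (ρ n) := fun n => ContDiffBump.hasCompactSupport_normed _
  have hρi : ∀ n, Integrable (ρ n) volume := fun n => ContDiffBump.integrable_normed _
  have hρ0 : ∀ n x, 0 ≤ ρ n x := fun n x => ContDiffBump.nonneg_normed _ x
  have hρ1 : ∀ n, ∫ x, ρ n x = 1 := fun n => ContDiffBump.integral_normed _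
  have hρsupp : ∀ n x, ρ n x ≠ 0 → ‖x‖ ≤ 1 := by
    intro n x hx
    have hx' : x ∈ Function.support (ρ n) := hx
    rw [hρd, ContDiffBump.support_normed_eq, mem_ball_zero_iff] at hx'
    refine hx'.le.trans ?_
    have : (1 : ℝ) / ((n : ℝ) + 1) ≤ 1 := by
      rw [div_le_one (by positivity)]
      have : (0 : ℝ) ≤ n := Nat.cast_nonneg n
      linarith
    exact this
  have hlim : ∀ᵐ x : Euc N, Tendsto (fun n => moll (ρ n) u x) atTop (𝓝 (u x)) := by
    have := ContDiffBump.ae_convolution_tendsto_right_of_locallyIntegrable (μ := volume)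
      (φ := bumpSeq N) (l := atTop) (K := 2) (g := u)
      (by
        have : Tendsto (fun n : ℕ => (1 : ℝ) / ((n : ℝ) + 1)) atTop (𝓝 0) :=
          tendsto_one_div_add_atTop_nhds_zero_nat
        exact this)
      (Eventually.of_forall fun n => by
        have : (1 : ℝ) / ((n : ℝ) + 1) ≤ 2 * (1 / (2 * ((n : ℝ) + 1))) := by
          have : (0 : ℝ) < n + 1 := by positivity
          apply le_of_eq; field_simp
        exact this) hu
    filter_upwards [this] with x hx
    refine hx.congr fun n => ?_
    rw [moll_apply', convolution_lsmul]
    rfl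
  have hbd : ∀ (b : ℝ) (Q : ℝ≥0∞), 1 ≤ Q → Q ≠ ⊤ → ∀ f : Euc N → ℝ, LocallyIntegrable f volume →
      ∀ n, eLpNorm (fun x => ww b x * moll (ρ n) f x) Q volume ≤
      (Real.toNNReal (2 ^ |b|) : NNReal) * eLpNorm (fun x => ww b x * f x) Q volume :=
    fun b Q hQ1 hQT f hf n => moll_bound b Q hQ1 hQT (ρ n) f (hρs n).continuous (hρi n) (hρ0 n)
      (hρ1 n) (hρsupp n) hf
  refine eLp_lim_le (fun n x => ww w x * moll (ρ n) u x) _ (fun n => ?_) ?_ (fun n => ?_)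
  · apply Continuous.aestronglyMeasurable
    exact (ww_cont w).mul (moll_contDiff _ u (hρs n) (hρc n) hu).continuous
  · filter_upwards [hlim] with x hx
    exact hx.const_mul _
  · have hb1 := hbd w1 1 le_rfl (by simp) u hu n
    have := hC (moll (ρ n) u) (moll_contDiff _ u (hρs n) (hρc n) hu)
      (hb1.trans_lt (ENNReal.mul_lt_top ENNReal.coe_lt_top hfin.lt_top)).ne
    refine this.trans ?_
    set I1 := eLpNorm (fun x => ww w1 x * u x) 1 volume with hI1
    set S := ∑ m : Fin k → Fin N, eLpNorm (fun x => ww wg x * g m x) P volume with hS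
    have hb2 : ∑ m : Fin k → Fin N, eLpNorm (fun x => ww wg x *
        pderivList (List.ofFn m) (moll (ρ n) u) x) P volume ≤ a2 * S := by
      rw [hS, Finset.mul_sum]
      refine Finset.sum_le_sum fun m _ => ?_
      rw [pderivList_moll_weak (List.ofFn m) (ρ n) u (g m) (hρs n) (hρc n) (hg m)]
      exact hbd wg P h1 hT (g m) (hg m).2.1 n
    calc _ ≤ C * (a1 * I1 + a2 * S) := by gcongr
      _ ≤ C * (a1 * (I1 + S) + a2 * (I1 + S)) := by
          gcongr
          · exact le_self_add
          · exact le_add_self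
      _ = _ := by push_cast; ring

lemma ww_mul {N : ℕ} (a b : ℝ) (x : Euc N) : ww a x * ww b x = ww (a + b) x :=
  (Real.rpow_add (one_add_pos x) a b).symm

lemma ww_fin {N : ℕ} (δ : ℝ) (hδ : 0 < δ) (q : ℝ≥0∞) (hq : 1 ≤ q) :
    eLpNorm (fun x : Euc N => ww (-δ - N * (q.toReal)⁻¹) x) q volume ≠ ⊤ := by
  by_cases hT : q = ⊤
  · subst hT
    refine (memLp_top_of_bound (ww_cont _).aestronglyMeasurable 1
      (Eventually.of_forall fun x => ?_)).2.ne
    rw [Real.norm_of_nonneg (ww_pos _ x).le]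
    refine Real.rpow_le_one_of_one_le_of_nonpos (by have := norm_nonneg x; linarith) ?_
    simp [hδ.le]
  · have hq0 : q ≠ 0 := (zero_lt_one.trans_le hq).ne'
    have hr : 0 < q.toReal := ENNReal.toReal_pos hq0 hT
    refine ((eLpNorm_lt_top_iff_lintegral_rpow_enorm_lt_top hq0 hT).2 ?_).ne
    have hfin := finite_integral_one_add_norm (E := Euc N) (μ := volume) (r := δ * q.toReal + N)
      (by simp; positivity)
    refine lt_of_le_of_lt (le_of_eq ?_) hfin
    refine lintegral_congr fun x => ?_
    rw [Real.enorm_of_nonneg (ww_pos _ x).le, ENNReal.ofReal_rpow_of_pos (ww_pos _ x), ww,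
      ← Real.rpow_mul (one_add_pos x).le]
    congr 2
    field_simp
    ring

lemma holder_one {N : ℕ} (τ δ : ℝ) (hδ : 0 < δ) (q : ℝ≥0∞) (hq : 1 ≤ q) :
    ∃ C : NNReal, ∀ u : Euc N → ℝ, AEStronglyMeasurable u volume →
      eLpNorm (fun x => ww (-τ - δ - N) x * u x) 1 volume ≤
        C * eLpNorm (fun x => wt N τ q x * u x) q volume := by
  have hc : q.HolderConjugate q.conjExponent := ENNReal.HolderConjugate.conjExponent hq
  set r := q.conjExponent with hr
  have hr1 : 1 ≤ r := by rw [hr, ENNReal.conjExponent]; exact le_self_add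
  have hsum : q⁻¹ + r⁻¹ = 1 := ENNReal.HolderConjugate.inv_add_inv_eq_one q r
  have hq1 : q⁻¹ ≠ ⊤ := ENNReal.inv_ne_top.2 (zero_lt_one.trans_le hq).ne'
  have hr2 : r⁻¹ ≠ ⊤ := ENNReal.inv_ne_top.2 (zero_lt_one.trans_le hr1).ne'
  have hsum' : q.toReal⁻¹ + r.toReal⁻¹ = 1 := by
    have := congrArg ENNReal.toReal hsum
    rwa [ENNReal.toReal_add hq1 hr2, ENNReal.toReal_inv, ENNReal.toReal_inv,
      ENNReal.toReal_one] at this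
  have hT : r.HolderTriple q 1 := ⟨by rw [add_comm, hsum, inv_one]⟩
  have hf := ww_fin (N := N) δ hδ r hr1
  refine ⟨(eLpNorm (fun x : Euc N => ww (-δ - N * (r.toReal)⁻¹) x) r volume).toNNReal,
    fun u hu => ?_⟩
  rw [ENNReal.coe_toNNReal hf]
  have e : (fun x => ww (-τ - δ - N) x * u x) =
      (fun x : Euc N => ww (-δ - N * (r.toReal)⁻¹) x) • (fun x => wt N τ q x * u x) := by
    ext x
    rw [Pi.smul_apply', smul_eq_mul, ← mul_assoc]
    congr 1
    have : wt N τ q x = ww (-τ - N / q.toReal) x := rfl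
    rw [this, ww_mul]
    congr 1
    have h3 : r.toReal⁻¹ = 1 - q.toReal⁻¹ := by linarith
    rw [h3]; ring
  rw [e]
  exact eLpNorm_smul_le_mul_eLpNorm (((ww_cont _).aestronglyMeasurable).mul hu)
    (ww_cont _).aestronglyMeasurable

lemma abs_le_gradNormK {N k : ℕ} (g : (Fin k → Fin N) → Euc N → ℝ) (m : Fin k → Fin N)
    (x : Euc N) : |g m x| ≤ gradNormK g x := by
  rw [gradNormK]
  refine Real.abs_le_sqrt ?_
  exact Finset.single_le_sum (f := fun m => g m x ^ 2) (fun i _ => sq_nonneg _) (Finset.mem_univ m)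

lemma gradNormK_le {N k : ℕ} (g : (Fin k → Fin N) → Euc N → ℝ) (x : Euc N) :
    gradNormK g x ≤ ∑ m, |g m x| := by
  rw [gradNormK]
  refine Real.sqrt_le_iff.2 ⟨Finset.sum_nonneg fun i _ => abs_nonneg _, ?_⟩
  have := Finset.sum_sq_le_sq_sum_of_nonneg (s := Finset.univ) (f := fun m => |g m x|)
    (fun i _ => abs_nonneg _)
  simpa only [sq_abs] using this

/-- Theorem 12(i). For `k ≥ 1`, `1 ≤ p < ∞`, `s ∉ {-k,…,-1}` and any
`1 ≤ q ≤ ∞`, the weighted Sobolev space `W^{k,q,p}_s` is contained in `W^{k,p,p}_s` and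
the inclusion is a continuous embedding: membership `u ∈ W^{k,q,p}_s` (i.e.
`u ∈ L^q_{s+k}` and `∇^k u ∈ (L^p_s)^{ν(k,N)}`) implies `u ∈ L^p_{s+k}`, with the
`W^{k,p,p}_s`-norm dominated by a constant multiple of the `W^{k,q,p}_s`-norm. -/
theorem stmt_16 {N : ℕ} (hN : 1 ≤ N) (k : ℕ) (hk : 1 ≤ k) (p s : ℝ) (hp : 1 ≤ p)
    (hs : ∀ m : ℕ, 1 ≤ m → m ≤ k → s ≠ -(m : ℝ)) :
    ∀ q : ℝ≥0∞, 1 ≤ q →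
      ∃ C : ℝ, 0 < C ∧
        ∀ (u : Euc N → ℝ) (g : (Fin k → Fin N) → Euc N → ℝ),
          (∀ m, IsWeakDerivList (List.ofFn m) u (g m)) →
          (∀ m, MemLs N s (ENNReal.ofReal p) (g m)) →
          MemLs N (s + k) q u →
          MemLs N (s + k) (ENNReal.ofReal p) u ∧
            LsNorm N (s + k) (ENNReal.ofReal p) u
                + LsNorm N s (ENNReal.ofReal p) (gradNormK g)
              ≤ C * (LsNorm N (s + k) q u
                + LsNorm N s (ENNReal.ofReal p) (gradNormK g)) := by
  intro q hq
  set P : ℝ≥0∞ := ENNReal.ofReal p with hP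
  have h1 : 1 ≤ P := by rw [hP]; exact ENNReal.one_le_ofReal.2 hp
  have hT : P ≠ ⊤ := ENNReal.ofReal_ne_top
  obtain ⟨δ, hδ, C0, hC0⟩ := weak_main (N := N) k hk s hs P h1 hT
  obtain ⟨C1, hC1⟩ := holder_one (N := N) (s + k) δ hδ q hq
  set n : ℕ := Fintype.card (Fin k → Fin N) with hn
  refine ⟨(C0 : ℝ) * C1 + C0 * n + 1, by positivity, fun u g hg hgm hu => ?_⟩
  have hul : LocallyIntegrable u volume := (hg fun _ => ⟨0, hN⟩).1
  have hum := hul.aestronglyMeasurable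
  set A := eLpNorm (fun x => wt N (s + k) P x * u x) P volume with hA
  set B := eLpNorm (fun x => wt N (s + k) q x * u x) q volume with hB
  set G := eLpNorm (fun x => wt N s P x * gradNormK g x) P volume with hG
  have hBT : B ≠ ⊤ := hu.2.ne
  have hwpos : ∀ x, 0 ≤ wt N s P x := fun x => (ww_pos _ x).le
  have hGT : G ≠ ⊤ := by
    have hmem : MemLp (fun x => ∑ m, ‖wt N s P x * g m x‖) P volume :=
      memLp_finsetSum _ fun m _ => (hgm m).norm
    refine (lt_of_le_of_lt (eLpNorm_mono_real fun x => ?_) hmem.2).ne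
    rw [norm_mul, Real.norm_of_nonneg (hwpos x), Real.norm_of_nonneg (show 0 ≤ gradNormK g x from Real.sqrt_nonneg _)]
    simp only [norm_mul, Real.norm_of_nonneg (hwpos x), Real.norm_eq_abs, ← Finset.mul_sum]
    exact mul_le_mul_of_nonneg_left (gradNormK_le g x) (hwpos x)
  have hgG : ∀ m, eLpNorm (fun x => wt N s P x * g m x) P volume ≤ G := by
    intro m
    refine eLpNorm_mono_real fun x => ?_
    rw [norm_mul, Real.norm_of_nonneg (hwpos x)]
    exact mul_le_mul_of_nonneg_left (abs_le_gradNormK g m x) (hwpos x)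
  have hI := hC1 u hum
  have hmain : A ≤ C0 * (C1 * B + n * G) := by
    refine (hC0 u g hul hg (hI.trans_lt (ENNReal.mul_lt_top ENNReal.coe_lt_top hBT.lt_top)).ne).trans
      ?_
    gcongr
    refine (Finset.sum_le_sum fun m _ => hgG m).trans (le_of_eq ?_)
    rw [Finset.sum_const, nsmul_eq_mul, Finset.card_univ]
  have hRT : (C0 : ℝ≥0∞) * (C1 * B + n * G) ≠ ⊤ :=
    ENNReal.mul_ne_top ENNReal.coe_ne_top (ENNReal.add_ne_top.2
      ⟨ENNReal.mul_ne_top ENNReal.coe_ne_top hBT, ENNReal.mul_ne_top (by simp) hGT⟩)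
  refine ⟨⟨((ww_cont _).aestronglyMeasurable).mul hum, hmain.trans_lt hRT.lt_top⟩, ?_⟩
  have hr := ENNReal.toReal_mono hRT hmain
  rw [ENNReal.toReal_mul, ENNReal.toReal_add (ENNReal.mul_ne_top ENNReal.coe_ne_top hBT)
    (ENNReal.mul_ne_top (by simp) hGT), ENNReal.toReal_mul, ENNReal.toReal_mul,
    ENNReal.coe_toReal, ENNReal.coe_toReal, ENNReal.toReal_natCast] at hr
  change A.toReal + G.toReal ≤ _ * (B.toReal + G.toReal)
  have hB0 : 0 ≤ B.toReal := ENNReal.toReal_nonneg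
  have hG0 : 0 ≤ G.toReal := ENNReal.toReal_nonneg
  have c0 : (0 : ℝ) ≤ C0 := C0.coe_nonneg
  have c1 : (0 : ℝ) ≤ C1 := C1.coe_nonneg
  have e1 : 0 ≤ (C0 : ℝ) * C1 * G.toReal := by positivity
  have e2 : 0 ≤ (C0 : ℝ) * n * B.toReal := by positivity
  nlinarith

end
end
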